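/- arXiv:1301.6251 — 4 statements merged into one kernel-verified Lean document; each statement's English description precedes it below -/
import Mathlib

section
/- The field of constants k(X)^d equals k(w_0,…,w_{m−1}), where m = n − φ(n) and w_j = u_{0+j}^{c_0} u_{1+j}^{c_1} ⋯ u_{φ(n)+j}^{c_{φ(n)}}. Consequently k(X)^d is a purely transcendental extension of k of transcendence degree n − φ(n). -/
open MvPolynomial

/-- The linear form `u_j = Σ_i ε^{ij} x_i`, viewed in the rational function field
`k(x_0,…,x_{n-1})` (the fraction field of the polynomial ring). -/
noncomputable def uForm {k : Type*} [Field k] (n : ℕ) [NeZero n] (ε : k) (j : ZMod n) :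
    FractionRing (MvPolynomial (ZMod n) k) :=
  algebraMap (MvPolynomial (ZMod n) k) (FractionRing (MvPolynomial (ZMod n) k))
    (∑ i : ZMod n, C (ε ^ (i * j).val) * X i)

/-- The rational monomial `w_j = u_j^{c_0} u_{j+1}^{c_1} ⋯ u_{j+φ(n)}^{c_{φ(n)}},`
where `c_0,…,c_{φ(n)}` are the coefficients of the `n`-th cyclotomic polynomial. -/
noncomputable def wMonomial {k : Type*} [Field k] (n : ℕ) [NeZero n] (ε : k) (j : ℕ) :
    FractionRing (MvPolynomial (ZMod n) k) :=
  ∏ i ∈ Finset.range (n.totient + 1),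
    uForm n ε ((i : ZMod n) + (j : ZMod n)) ^ ((Polynomial.cyclotomic n ℤ).coeff i)

section
variable {k : Type*} [Field k]

/-- The linear change of variables `X j ↦ u_j`. -/
noncomputable def sg (n : ℕ) [NeZero n] (ε : k) :
    MvPolynomial (ZMod n) k →ₐ[k] MvPolynomial (ZMod n) k :=
  aeval fun j => ∑ i : ZMod n, C (ε ^ (i * j).val) * X i

theorem sg_surj [CharZero k] (n : ℕ) [NeZero n] (ε : k) (hε : IsPrimitiveRoot ε n) :
    Function.Surjective (sg n ε) := by
  rw [← AlgHom.range_eq_top, eq_top_iff, ← MvPolynomial.adjoin_range_X, Algebra.adjoin_le_iff]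
  rintro _ ⟨i, rfl⟩
  let χ := AddChar.zmodChar n hε.pow_eq_one
  have hχ : χ.IsPrimitive := AddChar.zmodChar_primitive_of_primitive_root n hε
  have hn : (n : k) ≠ 0 := Nat.cast_ne_zero.mpr (NeZero.ne n)
  have hs : ∀ l, ∑ j : ZMod n, χ (-(i * j)) * χ (l * j) = if l = i then (n : k) else 0 := by
    intro l
    have := AddChar.sum_mulShift (l - i) hχ
    rw [ZMod.card] at this
    simp only [sub_eq_zero] at this
    push_cast at this
    rw [← this]
    refine Finset.sum_congr rfl fun j _ => ?_
    rw [← AddChar.map_add_eq_mul]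
    congr 1; ring
  refine ⟨C (n : k)⁻¹ * ∑ j, C (χ (-(i * j))) * X j, ?_⟩
  change sg n ε _ = _
  have h1 : ∀ j, (sg n ε) (X j) = ∑ l : ZMod n, C (χ (l * j)) * X l := by
    intro j; simp [sg, χ, AddChar.zmodChar_apply]
  have hC : ∀ c : k, sg n ε (C c) = C c := fun c => by simp [sg]
  simp only [map_mul, map_sum, h1, hC, Finset.mul_sum]
  rw [Finset.sum_comm]
  have : ∀ l, ∑ j : ZMod n, C (n:k)⁻¹ * (C (χ (-(i * j))) * (C (χ (l * j)) * X l)) =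
      if l = i then (X i : MvPolynomial (ZMod n) k) else 0 := by
    intro l
    have : C (n:k)⁻¹ * (C (∑ j : ZMod n, χ (-(i * j)) * χ (l * j)) * X l) =
      if l = i then (X i : MvPolynomial (ZMod n) k) else 0 := by
      rw [hs]
      split_ifs with h
      · subst h
        rw [← mul_assoc, ← C_mul, inv_mul_cancel₀ hn]; simp
      · simp
    rw [← this]
    simp only [map_sum, map_mul, Finset.sum_mul, Finset.mul_sum, mul_assoc]
  simp [this]

theorem inj_of_surj_noeth {R : Type*} [CommRing R] [IsNoetherianRing R] (f : R →+* R)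
    (hf : Function.Surjective f) : Function.Injective f := by
  rw [injective_iff_map_eq_zero]
  intro x hx
  have hm : Monotone fun m : ℕ => RingHom.ker (f ^ m) := by
    refine monotone_nat_of_le_succ fun m y hy => ?_
    rw [RingHom.mem_ker] at hy ⊢
    rw [pow_succ', RingHom.coe_mul, Function.comp_apply, hy, map_zero]
  obtain ⟨m, hm'⟩ := monotone_stabilizes_iff_noetherian.mpr ‹IsNoetherianRing R› ⟨_, hm⟩
  have hs : Function.Surjective (f ^ m) := by
    rw [RingHom.coe_pow]
    exact hf.iterate m
  obtain ⟨y, rfl⟩ := hs x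
  have h1 : y ∈ RingHom.ker (f ^ (m + 1)) := by
    rw [RingHom.mem_ker, pow_succ', RingHom.coe_mul, Function.comp_apply, hx]
  have h2 := hm' (m + 1) (by omega)
  simp only [OrderHom.coe_mk] at h2
  rw [← h2] at h1
  exact h1

theorem sg_inj [CharZero k] (n : ℕ) [NeZero n] (ε : k) (hε : IsPrimitiveRoot ε n) :
    Function.Injective (sg n ε) :=
  inj_of_surj_noeth (sg n ε).toRingHom (sg_surj n ε hε)

/-- Diagonal derivation. -/
noncomputable def dg (n : ℕ) [NeZero n] (ε : k) :
    Derivation k (MvPolynomial (ZMod n) k) (MvPolynomial (ZMod n) k) :=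
  mkDerivation k fun j => C (ε ^ j.val)⁻¹ * X j

/-- eigenvalue of a monomial. -/
noncomputable def eig (n : ℕ) [NeZero n] (ε : k) (a : ZMod n → ℤ) : k :=
  ∑ j, (a j : k) * (ε ^ j.val)⁻¹

theorem dg_monomial (n : ℕ) [NeZero n] (ε : k) (a : ZMod n →₀ ℕ) (c : k) :
    dg n ε (monomial a c) = C (eig n ε fun j => (a j : ℤ)) * monomial a c := by
  rw [dg, mkDerivation_monomial, Finsupp.sum_fintype _ _ (by simp)]
  simp only [eig, map_sum, Finset.sum_mul, Finset.smul_sum]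
  refine Finset.sum_congr rfl fun j _ => ?_
  by_cases h : a j = 0
  · simp [h]
  have : monomial a c = monomial (a - Finsupp.single j 1) c * X j := by
    rw [X, monomial_mul, mul_one, tsub_add_cancel_of_le]
    simpa using Nat.one_le_iff_ne_zero.mpr h
  rw [this]
  simp only [smul_eq_mul, smul_eq_C_mul]
  rw [show (monomial (a - Finsupp.single j 1)) (a j : k) = C (a j : k) * monomial (a - Finsupp.single j 1) 1 by rw [C_mul_monomial, mul_one]]
  rw [show (monomial (a - Finsupp.single j 1)) c = C c * monomial (a - Finsupp.single j 1) 1 by rw [C_mul_monomial, mul_one]]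
  simp only [map_mul, Int.cast_natCast]
  ring

theorem dg_coeff (n : ℕ) [NeZero n] (ε : k) (a : ZMod n →₀ ℕ) (p : MvPolynomial (ZMod n) k) :
    coeff a (dg n ε p) = eig n ε (fun j => (a j : ℤ)) * coeff a p := by
  classical
  induction p using MvPolynomial.induction_on' with
  | monomial b c =>
    rw [dg_monomial, coeff_C_mul, coeff_monomial]
    split_ifs with h
    · rw [h]
    · simp
  | add p q hp hq => simp [hp, hq, mul_add]

theorem dg_eigen (n : ℕ) [NeZero n] (ε : k) (p : MvPolynomial (ZMod n) k) (h : p ∣ dg n ε p) :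
    ∃ r : k, dg n ε p = C r * p := by
  by_cases h0 : dg n ε p = 0
  · exact ⟨0, by simp [h0]⟩
  obtain ⟨R, hR⟩ := h
  have hp : p ≠ 0 := by rintro rfl; simp at h0
  have hR0 : R ≠ 0 := by rintro rfl; simp [hR] at h0
  have h1 := totalDegree_mul_of_isDomain hp hR0
  have h2 : (dg n ε p).totalDegree ≤ p.totalDegree := by
    apply totalDegree_le_of_support_subset
    intro a ha
    rw [mem_support_iff, dg_coeff] at ha
    exact mem_support_iff.mpr (right_ne_zero_of_mul ha)
  rw [hR] at h2
  have : R.totalDegree = 0 := by omega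
  rw [totalDegree_eq_zero_iff_eq_C] at this
  exact ⟨R.coeff 0, by rw [hR, mul_comm, ← this]⟩

theorem eig_of_mem (n : ℕ) [NeZero n] (ε : k) (p : MvPolynomial (ZMod n) k) (r : k)
    (h : dg n ε p = C r * p) (a) (ha : a ∈ p.support) : eig n ε (fun j => (a j : ℤ)) = r := by
  have := congrArg (coeff a) h
  rw [dg_coeff, coeff_C_mul] at this
  exact mul_right_cancel₀ (mem_support_iff.mp ha) this

theorem uForm_eq (n : ℕ) [NeZero n] (ε : k) (j : ZMod n) :
    uForm n ε j = algebraMap _ _ (sg n ε (X j)) := by simp [uForm, sg]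

theorem uForm_ne [CharZero k] (n : ℕ) [NeZero n] (ε : k) (hε : IsPrimitiveRoot ε n) (j : ZMod n) :
    uForm n ε j ≠ 0 := by
  rw [uForm_eq, Ne, map_eq_zero_iff _ (IsFractionRing.injective _ _),
    map_eq_zero_iff _ (sg_inj n ε hε)]
  exact X_ne_zero j

theorem d_uForm (n : ℕ) [NeZero n] (ε : k) (hε : IsPrimitiveRoot ε n)
    (d : Derivation k (FractionRing (MvPolynomial (ZMod n) k))
      (FractionRing (MvPolynomial (ZMod n) k)))
    (hd : ∀ j : ZMod n,
      d (algebraMap (MvPolynomial (ZMod n) k) (FractionRing (MvPolynomial (ZMod n) k)) (X j))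
        = algebraMap (MvPolynomial (ZMod n) k) (FractionRing (MvPolynomial (ZMod n) k))
            (X (j + 1))) (j : ZMod n) :
    d (uForm n ε j) = (ε ^ j.val)⁻¹ • uForm n ε j := by
  let χ := AddChar.zmodChar n hε.pow_eq_one
  have hχ : ∀ a, ε ^ a.val = χ a := fun a => rfl
  simp only [uForm, hχ, map_sum, ← smul_eq_C_mul]
  have hs : ∀ (c : k) (p : MvPolynomial (ZMod n) k),
    algebraMap _ (FractionRing (MvPolynomial (ZMod n) k)) (c • p) = c • algebraMap _ (FractionRing (MvPolynomial (ZMod n) k)) p := fun c p => by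
      rw [Algebra.algebraMap_eq_smul_one, smul_assoc, ← Algebra.algebraMap_eq_smul_one]
  simp only [hs, d.map_smul, hd, Finset.smul_sum, smul_smul]
  rw [← Equiv.sum_comp (Equiv.addRight (1 : ZMod n)) (fun i => ((χ j)⁻¹ * χ (i * j)) • algebraMap (MvPolynomial (ZMod n) k) (FractionRing (MvPolynomial (ZMod n) k)) (X i))]
  refine Finset.sum_congr rfl fun i _ => ?_
  simp only [Equiv.coe_addRight]
  congr 1
  have : χ j ≠ 0 := by rw [← hχ]; exact pow_ne_zero _ (hε.ne_zero (NeZero.ne n))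
  rw [add_mul, one_mul, AddChar.map_add_eq_mul]
  field_simp

theorem d_sg (n : ℕ) [NeZero n] (ε : k) (hε : IsPrimitiveRoot ε n)
    (d : Derivation k (FractionRing (MvPolynomial (ZMod n) k))
      (FractionRing (MvPolynomial (ZMod n) k)))
    (hd : ∀ j : ZMod n,
      d (algebraMap (MvPolynomial (ZMod n) k) (FractionRing (MvPolynomial (ZMod n) k)) (X j))
        = algebraMap (MvPolynomial (ZMod n) k) (FractionRing (MvPolynomial (ZMod n) k))
            (X (j + 1))) (p : MvPolynomial (ZMod n) k) :
    d (algebraMap _ _ (sg n ε p)) = algebraMap _ _ (sg n ε (dg n ε p)) := by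
  have hC : ∀ c : k, sg n ε (C c) = C c := fun c => by simp [sg]
  have hC' : ∀ c : k, algebraMap (MvPolynomial (ZMod n) k) (FractionRing (MvPolynomial (ZMod n) k)) (C c) = algebraMap k _ c := fun c => rfl
  induction p using MvPolynomial.induction_on with
  | C c =>
    rw [hC, hC', d.map_algebraMap]
    have : (C c : MvPolynomial (ZMod n) k) = algebraMap k _ c := rfl
    rw [this, Derivation.map_algebraMap]; simp
  | add p q hp hq => simp only [map_add, hp, hq]
  | mul_X p i hp =>
    rw [map_mul, map_mul, d.leibniz, hp, ← uForm_eq, d_uForm n ε hε d hd, Derivation.leibniz]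
    rw [show dg n ε (X i) = C (ε ^ i.val)⁻¹ * X i by simp [dg]]
    simp only [map_add, map_mul, smul_eq_mul, hC, hC', ← uForm_eq, Algebra.smul_def]

/-- Laurent monomials in the `u_j`. -/
noncomputable def um (n : ℕ) [NeZero n] (ε : k) (a : ZMod n → ℤ) :
    FractionRing (MvPolynomial (ZMod n) k) := ∏ j, uForm n ε j ^ a j

theorem um_ne [CharZero k] (n : ℕ) [NeZero n] (ε : k) (hε : IsPrimitiveRoot ε n)
    (a : ZMod n → ℤ) : um n ε a ≠ 0 :=
  Finset.prod_ne_zero_iff.mpr fun j _ => zpow_ne_zero _ (uForm_ne n ε hε j)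

theorem um_add [CharZero k] (n : ℕ) [NeZero n] (ε : k) (hε : IsPrimitiveRoot ε n)
    (a b : ZMod n → ℤ) : um n ε (fun j => a j + b j) = um n ε a * um n ε b := by
  simp only [um, ← Finset.prod_mul_distrib]
  exact Finset.prod_congr rfl fun j _ => zpow_add₀ (uForm_ne n ε hε j) _ _

theorem um_sub [CharZero k] (n : ℕ) [NeZero n] (ε : k) (hε : IsPrimitiveRoot ε n)
    (a b : ZMod n → ℤ) : um n ε (fun j => a j - b j) = um n ε a / um n ε b := by
  simp only [um, ← Finset.prod_div_distrib]
  exact Finset.prod_congr rfl fun j _ => zpow_sub₀ (uForm_ne n ε hε j) _ _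

theorem sg_monomial (n : ℕ) [NeZero n] (ε : k) (a : ZMod n →₀ ℕ) (c : k) :
    algebraMap _ (FractionRing (MvPolynomial (ZMod n) k)) (sg n ε (monomial a c)) =
      c • um n ε (fun j => (a j : ℤ)) := by
  rw [sg, aeval_monomial, Finsupp.prod_fintype _ _ (by simp), map_mul, map_prod, Algebra.smul_def]
  congr 1
  refine Finset.prod_congr rfl fun j _ => ?_
  rw [map_pow, zpow_natCast, uForm]

theorem sg_sum (n : ℕ) [NeZero n] (ε : k) (p : MvPolynomial (ZMod n) k) :
    algebraMap _ (FractionRing (MvPolynomial (ZMod n) k)) (sg n ε p) =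
      ∑ a ∈ p.support, coeff a p • um n ε (fun j => (a j : ℤ)) := by
  conv_lhs => rw [p.as_sum]
  simp only [map_sum, sg_monomial]

theorem um_linInd [CharZero k] (n : ℕ) [NeZero n] (ε : k) (hε : IsPrimitiveRoot ε n) :
    LinearIndependent k (um n ε) := by
  classical
  rw [linearIndependent_iff']
  intro s g hg a ha
  -- a common shift
  obtain ⟨N, hN⟩ : ∃ N : ℤ, ∀ b ∈ s, ∀ j, 0 ≤ b j + N := by
    refine ⟨∑ b ∈ s, ∑ j, |b j|, fun b hb j => ?_⟩
    have h1 : |b j| ≤ ∑ j, |b j| :=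
      Finset.single_le_sum (f := fun j => |b j|) (fun _ _ => abs_nonneg _) (Finset.mem_univ j)
    have h2 : ∑ j, |b j| ≤ ∑ b ∈ s, ∑ j, |b j| :=
      Finset.single_le_sum (f := fun b : ZMod n → ℤ => ∑ j, |b j|)
        (fun _ _ => Finset.sum_nonneg fun _ _ => abs_nonneg _) hb
    have := neg_abs_le (b j)
    linarith
  let e : (ZMod n → ℤ) → (ZMod n →₀ ℕ) := fun b => Finsupp.equivFunOnFinite.symm fun j => (b j + N).toNat
  have he : ∀ b ∈ s, ∀ j, ((e b j : ℕ) : ℤ) = b j + N := fun b hb j => by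
    simp [e, hN b hb j]
  have hz : ∑ b ∈ s, monomial (e b) (g b) = 0 := by
    apply sg_inj n ε hε
    apply IsFractionRing.injective _ (FractionRing (MvPolynomial (ZMod n) k))
    simp only [map_sum, sg_monomial, map_zero]
    have : ∀ b ∈ s, g b • um n ε (fun j => (e b j : ℤ)) = (g b • um n ε b) * um n ε (fun _ => N) := by
      intro b hb
      rw [smul_mul_assoc, ← um_add n ε hε]
      simp only [he b hb]
    rw [Finset.sum_congr rfl this, ← Finset.sum_mul, hg, zero_mul]
  have hc := congrArg (coeff (e a)) hz
  rw [coeff_sum, Finset.sum_eq_single a] at hc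
  · simpa using hc
  · intro b hb hba
    rw [coeff_monomial, if_neg]
    intro h
    apply hba
    funext j
    have := he a ha j
    rw [← h, he b hb j] at this
    linarith
  · exact fun h => absurd ha h

theorem prod_zmod {M : Type*} [CommMonoid M] (n : ℕ) [NeZero n] (f : ZMod n → M) :
    ∏ j, f j = ∏ i ∈ Finset.range n, f (i : ZMod n) := by
  symm
  refine Finset.prod_bij (fun i _ => (i : ZMod n)) (by simp) ?_ ?_ (by simp)
  · intro a ha b hb h
    have := congrArg ZMod.val h
    rwa [ZMod.val_cast_of_lt (Finset.mem_range.mp ha), ZMod.val_cast_of_lt (Finset.mem_range.mp hb)] at this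
  · intro b _
    exact ⟨b.val, Finset.mem_range.mpr b.val_lt, by simp⟩

theorem um_range (n : ℕ) [NeZero n] (ε : k) (f : ℕ → ℤ) :
    um n ε (fun j => f j.val) = ∏ i ∈ Finset.range n, uForm n ε (i : ZMod n) ^ f i := by
  rw [um, prod_zmod]
  refine Finset.prod_congr rfl fun i hi => ?_
  rw [ZMod.val_cast_of_lt (Finset.mem_range.mp hi)]

theorem w_eq (n : ℕ) [NeZero n] (ε : k) (j : ℕ) (hj : j < n - n.totient) :
    wMonomial n ε j =
      um n ε (fun i => (Polynomial.X ^ j * Polynomial.cyclotomic n ℤ).coeff i.val) := by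
  rw [um_range, wMonomial]
  obtain ⟨r, hr⟩ : ∃ r, n = j + ((n.totient + 1) + r) := ⟨n - j - (n.totient + 1), by omega⟩
  conv_rhs => rw [show Finset.range n = Finset.range (j + ((n.totient + 1) + r)) from congrArg _ hr]
  rw [Finset.prod_range_add _ j, Finset.prod_range_add _ (n.totient + 1) r]
  rw [Finset.prod_eq_one (s := Finset.range j), Finset.prod_eq_one (s := Finset.range r), one_mul, mul_one]
  · refine Finset.prod_congr rfl fun i _ => ?_
    rw [add_comm j i, Polynomial.coeff_X_pow_mul]
    push_cast; rfl
  · intro i _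
    rw [add_comm j, Polynomial.coeff_X_pow_mul, Polynomial.coeff_eq_zero_of_natDegree_lt, zpow_zero]
    rw [Polynomial.natDegree_cyclotomic]; omega
  · intro i hi
    rw [Polynomial.coeff_X_pow_mul', if_neg (by simpa using hi), zpow_zero]

theorem um_w [CharZero k] (n : ℕ) [NeZero n] (ε : k) (hε : IsPrimitiveRoot ε n)
    (b : Fin (n - n.totient) → ℤ) :
    um n ε (fun i => ((∑ j, Polynomial.C (b j) * Polynomial.X ^ (j : ℕ)) *
      Polynomial.cyclotomic n ℤ).coeff i.val) = ∏ j : Fin (n - n.totient), wMonomial n ε (j : ℕ) ^ b j := by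
  have : ∀ j : Fin (n - n.totient), wMonomial n ε (j : ℕ) ^ b j = ∏ i, uForm n ε i ^
      ((Polynomial.X ^ (j : ℕ) * Polynomial.cyclotomic n ℤ).coeff i.val * b j) := by
    intro j
    rw [w_eq n ε j j.2, um, ← Finset.prod_zpow]
    simp only [zpow_mul]
  simp only [this]
  rw [Finset.prod_comm, um]
  refine Finset.prod_congr rfl fun i _ => ?_
  have hz : ∀ (s : Finset (Fin (n - n.totient))) (f : Fin (n - n.totient) → ℤ),
      ∏ j ∈ s, uForm n ε i ^ f j = uForm n ε i ^ ∑ j ∈ s, f j := by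
    classical
    intro s f
    induction s using Finset.induction_on with
    | empty => simp
    | insert a s ha ih =>
      rw [Finset.prod_insert ha, Finset.sum_insert ha, ih, zpow_add₀ (uForm_ne n ε hε i)]
  rw [hz, Finset.sum_mul, Polynomial.finsetSum_coeff]
  congr 1
  refine Finset.sum_congr rfl fun j _ => ?_
  rw [mul_assoc, Polynomial.coeff_C_mul, mul_comm]

theorem eig_range [CharZero k] (n : ℕ) [NeZero n] (ε : k) (f : ℕ → ℤ) :
    eig n ε (fun j => f j.val) =
      Polynomial.aeval ε⁻¹ (∑ i ∈ Finset.range n, Polynomial.C (f i) * Polynomial.X ^ i) := by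
  simp only [eig, map_sum, map_mul, map_pow, Polynomial.aeval_X, Polynomial.aeval_C]
  symm
  refine Finset.sum_bij (fun i _ => (i : ZMod n)) (by simp) ?_ ?_ ?_
  · intro a ha b hb h
    have := congrArg ZMod.val h
    rwa [ZMod.val_cast_of_lt (Finset.mem_range.mp ha), ZMod.val_cast_of_lt (Finset.mem_range.mp hb)] at this
  · intro b _
    exact ⟨b.val, Finset.mem_range.mpr b.val_lt, by simp⟩
  · intro i hi
    rw [ZMod.val_cast_of_lt (Finset.mem_range.mp hi)]
    simp

theorem coeff_range (n : ℕ) (f : ℕ → ℤ) (i : ℕ) :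
    (∑ i ∈ Finset.range n, Polynomial.C (f i) * Polynomial.X ^ i : Polynomial ℤ).coeff i =
      if i < n then f i else 0 := by
  simp [Polynomial.finsetSum_coeff, Polynomial.coeff_X_pow]

/-- A Laurent monomial killed by `d` is a product of powers of the `w_j`. -/
theorem um_eq_prod_w [CharZero k] (n : ℕ) [NeZero n] (ε : k) (hε : IsPrimitiveRoot ε n)
    (a : ZMod n → ℤ) (ha : eig n ε a = 0) :
    ∃ b : Fin (n - n.totient) → ℤ, um n ε a = ∏ j : Fin (n - n.totient), wMonomial n ε (j : ℕ) ^ b j := by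
  set f : ℕ → ℤ := fun i => a (i : ZMod n) with hf
  have haf : a = fun j => f j.val := by funext j; simp [hf]
  set A : Polynomial ℤ := ∑ i ∈ Finset.range n, Polynomial.C (f i) * Polynomial.X ^ i with hA
  have hAc : ∀ i, A.coeff i = if i < n then f i else 0 := coeff_range n f
  have hA0 : Polynomial.aeval ε⁻¹ A = 0 := by rw [hA, ← eig_range, ← haf, ha]
  have hpos : 0 < n := NeZero.pos n
  have hdvd : Polynomial.cyclotomic n ℤ ∣ A := by
    rw [Polynomial.cyclotomic_eq_minpoly hε.inv hpos]
    exact minpoly.isIntegrallyClosed_dvd (hε.inv.isIntegral hpos) hA0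
  obtain ⟨B, hB⟩ := hdvd
  have hBc : ∀ i, n - n.totient ≤ i → B.coeff i = 0 := by
    intro i hi
    by_cases hB0 : B = 0
    · simp [hB0]
    apply Polynomial.coeff_eq_zero_of_natDegree_lt
    have h1 : A.natDegree < n := by
      have hA0 : A ≠ 0 := by rw [hB]; exact mul_ne_zero (Polynomial.cyclotomic_ne_zero n ℤ) hB0
      rw [Polynomial.natDegree_lt_iff_degree_lt hA0, Polynomial.degree_lt_iff_coeff_zero]
      intro m hm
      rw [hAc, if_neg (by omega)]
    rw [hB, Polynomial.natDegree_mul (Polynomial.cyclotomic_ne_zero n ℤ) hB0,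
      Polynomial.natDegree_cyclotomic] at h1
    omega
  refine ⟨fun j => B.coeff j, ?_⟩
  rw [← um_w n ε hε]
  have hBs : (∑ j : Fin (n - n.totient), Polynomial.C (B.coeff j) * Polynomial.X ^ (j : ℕ)) = B := by
    rw [Fin.sum_univ_eq_sum_range (fun j => Polynomial.C (B.coeff j) * Polynomial.X ^ j)]
    ext i
    rw [coeff_range]
    split_ifs with h
    · rfl
    · exact (hBc i (by omega)).symm
  rw [hBs, mul_comm, ← hB]
  congr 1
  funext j
  rw [hAc, if_pos j.val_lt]
  simp [hf]

theorem d_um [CharZero k] (n : ℕ) [NeZero n] (ε : k) (hε : IsPrimitiveRoot ε n)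
    (d : Derivation k (FractionRing (MvPolynomial (ZMod n) k))
      (FractionRing (MvPolynomial (ZMod n) k)))
    (hd : ∀ j : ZMod n,
      d (algebraMap (MvPolynomial (ZMod n) k) (FractionRing (MvPolynomial (ZMod n) k)) (X j))
        = algebraMap (MvPolynomial (ZMod n) k) (FractionRing (MvPolynomial (ZMod n) k))
            (X (j + 1))) (a : ZMod n → ℤ) :
    d (um n ε a) = eig n ε a • um n ε a := by
  classical
  have key : ∀ s : Finset (ZMod n), d (∏ j ∈ s, uForm n ε j ^ a j) =
      (∑ j ∈ s, (a j : k) * (ε ^ j.val)⁻¹) • ∏ j ∈ s, uForm n ε j ^ a j := by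
    intro s
    induction s using Finset.induction_on with
    | empty => simp
    | insert i s hi ih =>
      rw [Finset.prod_insert hi, Finset.sum_insert hi, d.leibniz, ih, Derivation.leibniz_zpow, d_uForm n ε hε d hd]
      have hu := uForm_ne n ε hε i
      have : uForm n ε i ^ (a i) = uForm n ε i ^ (a i - 1) * uForm n ε i := by
        rw [← zpow_add_one₀ hu]; simp
      rw [this]
      simp only [smul_eq_mul]
      simp only [Algebra.smul_def, map_add, map_mul, zsmul_eq_mul, map_intCast]
      ring
  exact key Finset.univ

theorem eig_w [CharZero k] (n : ℕ) [NeZero n] (ε : k) (hε : IsPrimitiveRoot ε n)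
    (j : ℕ) (hj : j < n - n.totient) :
    eig n ε (fun i => (Polynomial.X ^ j * Polynomial.cyclotomic n ℤ).coeff i.val) = 0 := by
  rw [eig_range]
  have : (∑ i ∈ Finset.range n, Polynomial.C ((Polynomial.X ^ j * Polynomial.cyclotomic n ℤ).coeff i) * Polynomial.X ^ i)
     = Polynomial.X ^ j * Polynomial.cyclotomic n ℤ := by
    ext i
    rw [coeff_range]
    split_ifs with h
    · rfl
    · rw [Polynomial.coeff_eq_zero_of_natDegree_lt]
      rw [Polynomial.natDegree_X_pow_mul _ (Polynomial.cyclotomic_ne_zero n ℤ), Polynomial.natDegree_cyclotomic]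
      omega
  rw [this, map_mul, Polynomial.cyclotomic_eq_minpoly hε.inv (NeZero.pos n), minpoly.aeval, mul_zero]

theorem part_one [CharZero k] (n : ℕ) [NeZero n] (ε : k) (hε : IsPrimitiveRoot ε n)
    (d : Derivation k (FractionRing (MvPolynomial (ZMod n) k))
      (FractionRing (MvPolynomial (ZMod n) k)))
    (hd : ∀ j : ZMod n,
      d (algebraMap (MvPolynomial (ZMod n) k) (FractionRing (MvPolynomial (ZMod n) k)) (X j))
        = algebraMap (MvPolynomial (ZMod n) k) (FractionRing (MvPolynomial (ZMod n) k))
            (X (j + 1))) (f : FractionRing (MvPolynomial (ZMod n) k)) :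
    d f = 0 ↔ f ∈ IntermediateField.adjoin k
            (Set.range fun j : Fin (n - n.totient) => wMonomial n ε (j : ℕ)) := by
  constructor
  · intro hf
    obtain ⟨P', Q', hrel, hPQ⟩ := IsFractionRing.exists_reduced_fraction (A := MvPolynomial (ZMod n) k) f
    obtain ⟨P, hP⟩ := sg_surj n ε hε P'
    obtain ⟨Q, hQ⟩ := sg_surj n ε hε Q'
    have hQ'0 : (Q' : MvPolynomial (ZMod n) k) ≠ 0 := nonZeroDivisors.ne_zero Q'.2
    have hQ0 : Q ≠ 0 := by rintro rfl; simp at hQ; exact hQ'0 hQ.symm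
    have hinj := IsFractionRing.injective (MvPolynomial (ZMod n) k) (FractionRing (MvPolynomial (ZMod n) k))
    set p := algebraMap _ (FractionRing (MvPolynomial (ZMod n) k)) (sg n ε P) with hp
    set q := algebraMap _ (FractionRing (MvPolynomial (ZMod n) k)) (sg n ε Q) with hq
    have hq0 : q ≠ 0 := by
      rw [hq, hQ, Ne, map_eq_zero_iff _ hinj]; exact hQ'0
    have hfpq : f * q = p := by
      rw [hq, hp, hP, hQ, ← hPQ, IsLocalization.mk'_spec]
    have hd1 : f * d q = d p := by
      rw [← hfpq, d.leibniz, hf]; simp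
    have hd2 : p * d q = d p * q := by rw [← hd1, ← hfpq]; ring
    rw [hp, hq, d_sg n ε hε d hd, d_sg n ε hε d hd] at hd2
    simp only [← map_mul] at hd2
    have hd3 := hinj hd2
    have hd4 := sg_inj n ε hε hd3
    have hdv : P ∣ dg n ε P := by
      have h1 : P' ∣ sg n ε (dg n ε P) * Q' := ⟨sg n ε (dg n ε Q), by rw [← hP, ← hQ, ← map_mul, ← map_mul, hd4]⟩
      obtain ⟨r, hr⟩ := hrel.dvd_of_dvd_mul_right h1
      obtain ⟨r, rfl⟩ := sg_surj n ε hε r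
      refine ⟨r, sg_inj n ε hε ?_⟩
      rw [hr, map_mul, hP]
    by_cases hP0 : P = 0
    · have : f = 0 := by
        have : f * q = 0 := by rw [hfpq, hp, hP0]; simp
        exact (mul_eq_zero.mp this).resolve_right hq0
      rw [this]; exact zero_mem _
    obtain ⟨r, hr⟩ := dg_eigen n ε P hdv
    have hrQ : dg n ε Q = C r * Q := by
      rw [hr] at hd4
      apply mul_left_cancel₀ hP0
      rw [hd4]; ring
    obtain ⟨b, hb⟩ := Finset.nonempty_iff_ne_empty.mpr (mt MvPolynomial.support_eq_empty.mp hQ0)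
    have hbr := eig_of_mem n ε Q r hrQ b hb
    have key : ∀ S : MvPolynomial (ZMod n) k, dg n ε S = C r * S →
        algebraMap _ (FractionRing (MvPolynomial (ZMod n) k)) (sg n ε S) / um n ε (fun j => (b j : ℤ)) ∈
          IntermediateField.adjoin k
            (Set.range fun j : Fin (n - n.totient) => wMonomial n ε (j : ℕ)) := by
      intro S hS
      rw [sg_sum, Finset.sum_div]
      refine sum_mem fun a ha => ?_
      rw [smul_div_assoc, ← um_sub n ε hε]
      refine IntermediateField.smul_mem _ ?_
      obtain ⟨c, hc⟩ := um_eq_prod_w n ε hε (fun j => (a j : ℤ) - (b j : ℤ)) (by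
        have := eig_of_mem n ε S r hS a ha
        rw [← hbr] at this
        simp only [eig, Int.cast_sub, sub_mul, Finset.sum_sub_distrib] at this ⊢
        rw [this, sub_self])
      rw [hc]
      refine prod_mem fun j _ => ?_
      exact zpow_mem (IntermediateField.subset_adjoin k _ (Set.mem_range_self j)) _
    have : f = (p / um n ε (fun j => (b j : ℤ))) / (q / um n ε (fun j => (b j : ℤ))) := by
      rw [div_div_div_cancel_right₀ (um_ne n ε hε _), ← hfpq, mul_div_cancel_right₀ _ hq0]
    rw [this]
    exact div_mem (key P hr) (key Q hrQ)
  · intro hf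
    induction hf using IntermediateField.adjoin_induction with
    | mem x hx =>
      obtain ⟨j, rfl⟩ := hx
      simp only
      rw [w_eq n ε j j.2, d_um n ε hε d hd, eig_w n ε hε j j.2, zero_smul]
    | algebraMap x => exact d.map_algebraMap x
    | add x y _ _ hx hy => rw [map_add, hx, hy, add_zero]
    | inv x _ hx => rw [d.leibniz_inv, hx, smul_zero]
    | mul x y _ _ hx hy => rw [d.leibniz, hx, hy, smul_zero, smul_zero, add_zero]

theorem part_two [CharZero k] (n : ℕ) [NeZero n] (ε : k) (hε : IsPrimitiveRoot ε n) :
    AlgebraicIndependent k (fun j : Fin (n - n.totient) => wMonomial n ε (j : ℕ)) := by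
  rw [algebraicIndependent_iff]
  intro p hp
  let Bp : (Fin (n - n.totient) →₀ ℕ) → Polynomial ℤ := fun b =>
    ∑ j, Polynomial.C (b j : ℤ) * Polynomial.X ^ (j : ℕ)
  have hBc : ∀ b (j : Fin (n - n.totient)), (Bp b).coeff j = b j := by
    intro b j
    simp [Bp, Polynomial.finsetSum_coeff, Polynomial.coeff_X_pow, Fin.val_inj]
  have hBd : ∀ b i, n ≤ i → (Bp b * Polynomial.cyclotomic n ℤ).coeff i = 0 := by
    intro b i hi
    simp only [Bp, Finset.sum_mul, Polynomial.finsetSum_coeff]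
    refine Finset.sum_eq_zero fun j _ => ?_
    rw [mul_assoc, Polynomial.coeff_C_mul, Polynomial.coeff_eq_zero_of_natDegree_lt, mul_zero]
    rw [Polynomial.natDegree_X_pow_mul _ (Polynomial.cyclotomic_ne_zero n ℤ), Polynomial.natDegree_cyclotomic]
    have := j.2
    omega
  let e : (Fin (n - n.totient) →₀ ℕ) → ZMod n → ℤ := fun b i =>
    (Bp b * Polynomial.cyclotomic n ℤ).coeff i.val
  have he : Function.Injective e := by
    intro b b' h
    have h1 : Bp b * Polynomial.cyclotomic n ℤ = Bp b' * Polynomial.cyclotomic n ℤ := by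
      ext i
      by_cases hi : i < n
      · have := congrFun h (i : ZMod n)
        simpa only [e, ZMod.val_cast_of_lt hi] using this
      · rw [hBd b i (by omega), hBd b' i (by omega)]
    have h2 := mul_right_cancel₀ (Polynomial.cyclotomic_ne_zero n ℤ) h1
    ext j
    have := hBc b j
    rw [h2, hBc b' j] at this
    exact_mod_cast this.symm
  have hli := (um_linInd n ε hε).comp e he
  rw [linearIndependent_iff'] at hli
  have hs : ∑ b ∈ p.support, coeff b p • (um n ε ∘ e) b = 0 := by
    rw [← hp, aeval_def, eval₂_eq']
    refine Finset.sum_congr rfl fun b _ => ?_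
    rw [Algebra.smul_def, Function.comp_apply]
    congr 1
    have := um_w n ε hε (fun j => (b j : ℤ))
    simp only [zpow_natCast] at this
    exact this
  have h0 := hli p.support (fun b => coeff b p) hs
  ext b
  by_cases hb : b ∈ p.support
  · simpa using h0 b hb
  · simpa using hb

end

/-- The field of constants `k(X)^d` of the cyclotomic derivation `d`
equals `k(w_0,…,w_{m-1})` with `m = n - φ(n)`, and the `w_j` are algebraically
independent over `k`; hence `k(X)^d` is purely transcendental over `k` of
transcendence degree `n - φ(n)`. -/
theorem stmt_5 {k : Type*} [Field k] [CharZero k] (n : ℕ) (hn : 3 ≤ n) [NeZero n]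
    (ε : k) (hε : IsPrimitiveRoot ε n)
    (d : Derivation k (FractionRing (MvPolynomial (ZMod n) k))
      (FractionRing (MvPolynomial (ZMod n) k)))
    (hd : ∀ j : ZMod n,
      d (algebraMap (MvPolynomial (ZMod n) k) (FractionRing (MvPolynomial (ZMod n) k)) (X j))
        = algebraMap (MvPolynomial (ZMod n) k) (FractionRing (MvPolynomial (ZMod n) k))
            (X (j + 1))) :
    {f : FractionRing (MvPolynomial (ZMod n) k) | d f = 0}
        = ↑(IntermediateField.adjoin k
            (Set.range fun j : Fin (n - n.totient) => wMonomial n ε (j : ℕ)))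
      ∧ AlgebraicIndependent k (fun j : Fin (n - n.totient) => wMonomial n ε (j : ℕ)) := by
  refine ⟨?_, part_two n ε hε⟩
  ext f
  exact part_one n ε hε d hd f
end

section
/- The ring of constants k[X]^d is a polynomial ring over k (i.e. there exist algebraically independent elements f_1,…,f_s ∈ k[X] with k[X]^d = k[f_1,…,f_s]) if and only if n is a power of a prime number. -/
open MvPolynomial

lemma cyc_aux {k : Type*} [Field k] [CharZero k] (p s : ℕ) (hp : p.Prime) (ζ : k)
    (hζ : IsPrimitiveRoot ζ (p ^ (s + 1))) (a : ℕ → ℤ)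
    (h : ∑ j ∈ Finset.range (p ^ (s + 1)), (a j : k) * ζ ^ j = 0) (j : ℕ)
    (hj : j + p ^ s < p ^ (s + 1)) : a (j + p ^ s) = a j := by
  have : Fact p.Prime := ⟨hp⟩
  have hpos : 0 < p ^ (s + 1) := pow_pos hp.pos _
  set P : Polynomial ℤ := ∑ j ∈ Finset.range (p ^ (s + 1)), Polynomial.monomial j (a j) with hP
  have hPc : ∀ i, i < p ^ (s + 1) → P.coeff i = a i := by
    intro i hi
    simp [hP, Polynomial.finsetSum_coeff, Polynomial.coeff_monomial, hi]
  have hPd : P.degree < (p ^ (s + 1) : ℕ) := by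
    rw [Polynomial.degree_lt_iff_coeff_zero]
    intro i hi
    simp only [hP, Polynomial.finsetSum_coeff, Polynomial.coeff_monomial]
    apply Finset.sum_eq_zero
    intro x hx
    rw [Finset.mem_range] at hx
    rw [if_neg]
    omega
  have hdvd : Polynomial.cyclotomic (p ^ (s + 1)) ℤ ∣ P := by
    rw [Polynomial.cyclotomic_eq_minpoly hζ hpos]
    apply minpoly.isIntegrallyClosed_dvd (hζ.isIntegral hpos)
    rw [hP, map_sum, ← h]
    apply Finset.sum_congr rfl
    intro i _
    simp [Polynomial.aeval_monomial]
  obtain ⟨Q, hQ⟩ := hdvd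
  have key : P * (Polynomial.X ^ p ^ s - 1) = (Polynomial.X ^ p ^ (s + 1) - 1) * Q := by
    rw [hQ, ← Polynomial.cyclotomic_prime_pow_mul_X_pow_sub_one ℤ p s]; ring
  have hQd : ∀ i, p ^ s ≤ i → Q.coeff i = 0 := by
    by_cases hQ0 : Q = 0
    · simp [hQ0]
    intro i hi
    apply Polynomial.coeff_eq_zero_of_natDegree_lt
    have h1 : P.natDegree < p ^ (s + 1) := by
      rw [Polynomial.natDegree_lt_iff_degree_lt]
      · exact hPd
      · rw [hQ]; exact mul_ne_zero (Polynomial.cyclotomic_ne_zero _ _) hQ0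
    rw [hQ, Polynomial.natDegree_mul (Polynomial.cyclotomic_ne_zero _ _) hQ0,
      Polynomial.natDegree_cyclotomic, Nat.totient_prime_pow_succ hp] at h1
    have h2 : p ^ (s + 1) = p ^ s * (p - 1) + p ^ s := by
      obtain ⟨q, rfl⟩ : ∃ q, p = q + 1 := ⟨p - 1, by have := hp.pos; omega⟩
      simp [pow_succ]; ring
    omega
  have h3 := congrArg (fun R => Polynomial.coeff R (j + p ^ s)) key
  simp only [mul_sub, sub_mul, Polynomial.coeff_sub, Polynomial.coeff_mul_X_pow, mul_one, one_mul,
    Polynomial.coeff_X_pow_mul'] at h3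
  rw [if_neg (by omega), hQd _ (by omega), hPc _ hj, hPc _ (by omega)] at h3
  omega

lemma D_prod {k : Type*} [Field k] {σ : Type*} (e : σ → k)
    (D : Derivation k (MvPolynomial σ k) (MvPolynomial σ k))
    (hD : ∀ j, D (X j) = C (e j) * X j) {ι : Type*} (s : Finset ι) (g : ι → σ) :
    D (∏ i ∈ s, X (g i)) = C (∑ i ∈ s, e (g i)) * ∏ i ∈ s, X (g i) := by
  classical
  induction s using Finset.induction_on with
  | empty => simp
  | insert a s ha ih =>
    rw [Finset.prod_insert ha, Finset.sum_insert ha, Derivation.leibniz, ih, hD]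
    simp only [smul_eq_mul, map_add]
    ring

lemma D_coeff {k : Type*} [Field k] {σ : Type*} [Fintype σ] (e : σ → k)
    (D : Derivation k (MvPolynomial σ k) (MvPolynomial σ k))
    (hD : ∀ j, D (X j) = C (e j) * X j) (F : MvPolynomial σ k) (α : σ →₀ ℕ) :
    coeff α (D F) = (∑ j, (α j : k) * e j) * coeff α F := by
  classical
  have hm : ∀ (β : σ →₀ ℕ), D (monomial β 1) =
      C (∑ j, (β j : k) * e j) * monomial β 1 := by
    intro β
    induction β using Finsupp.induction_linear with
    | zero => simp
    | add f g hf hg =>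
      rw [← one_mul (1 : k), ← monomial_mul, Derivation.leibniz, hf, hg]
      simp only [Finsupp.add_apply, Nat.cast_add, add_mul, Finset.sum_add_distrib, C_add,
        smul_eq_mul]
      ring
    | single a b =>
      rw [← X_pow_eq_monomial, Derivation.leibniz_pow, hD]
      rw [Finset.sum_eq_single a (by intro c _ hc; simp [hc.symm]) (by simp)]
      rcases b with _ | b
      · simp
      · simp [pow_succ]
        ring
  induction F using MvPolynomial.induction_on' with
  | monomial u a =>
    have : monomial u a = a • (monomial u 1 : MvPolynomial σ k) := by simp [smul_monomial]
    rw [this, D.map_smul, hm, coeff_smul, coeff_smul, coeff_C_mul, coeff_monomial]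
    split_ifs with h
    · subst h; simp [mul_comm]
    · simp
  | add p q hp hq => rw [map_add, coeff_add, hp, hq, coeff_add, mul_add]

lemma phi_exists {k : Type*} [Field k] [CharZero k] (n : ℕ) [NeZero n]
    (ε : k) (hε : IsPrimitiveRoot ε n)
    (d : Derivation k (MvPolynomial (ZMod n) k) (MvPolynomial (ZMod n) k))
    (hd : ∀ j : ZMod n, d (X j) = X (j + 1)) :
    ∃ φ : MvPolynomial (ZMod n) k ≃ₐ[k] MvPolynomial (ZMod n) k,
      ∀ j, d (φ (X j)) = C (AddChar.zmodChar n hε.pow_eq_one j) * φ (X j) := by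
  have hprim := AddChar.zmodChar_primitive_of_primitive_root n hε
  set χ := AddChar.zmodChar n hε.pow_eq_one
  have hn0 : (n : k) ≠ 0 := Nat.cast_ne_zero.2 (NeZero.ne n)
  let φ : MvPolynomial (ZMod n) k →ₐ[k] MvPolynomial (ZMod n) k :=
    aeval fun j => ∑ i, C (χ (-(j * i))) * X i
  let ψ : MvPolynomial (ZMod n) k →ₐ[k] MvPolynomial (ZMod n) k :=
    aeval fun i => C (n : k)⁻¹ * ∑ j, C (χ (i * j)) * X j
  have hsum := fun b => AddChar.sum_mulShift (ψ := χ) b hprim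
  refine ⟨AlgEquiv.ofAlgHom φ ψ ?_ ?_, ?_⟩
  · ext1 i
    simp only [φ, ψ, AlgHom.comp_apply, aeval_X, map_mul, map_sum, algHom_C, algebraMap_eq,
      AlgHom.id_apply]
    have : ∀ j, C (χ (i * j)) * ∑ l, C (χ (-(j * l))) * X l
        = ∑ l, C (χ (j * (i - l))) * (X l : MvPolynomial (ZMod n) k) := by
      intro j
      rw [Finset.mul_sum]
      refine Finset.sum_congr rfl fun l _ => ?_
      rw [← mul_assoc, ← C_mul, ← AddChar.map_add_eq_mul]
      congr 3; ring
    simp only [this]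
    rw [Finset.sum_comm]
    simp only [← Finset.sum_mul, ← map_sum, hsum, sub_eq_zero]
    rw [Finset.sum_eq_single i]
    · rw [if_pos rfl, ← mul_assoc, ← C_mul, ZMod.card, inv_mul_cancel₀ hn0, C_1, one_mul]
    · intro b _ hb; rw [if_neg (Ne.symm hb)]; simp
    · simp
  · ext1 i
    simp only [φ, ψ, AlgHom.comp_apply, aeval_X, map_mul, map_sum, algHom_C, algebraMap_eq,
      AlgHom.id_apply]
    have : ∀ j, C (χ (-(i * j))) * (C (n : k)⁻¹ * ∑ l, C (χ (j * l)) * X l)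
        = ∑ l, C (χ (j * (l - i))) * (C (n : k)⁻¹ * X l : MvPolynomial (ZMod n) k) := by
      intro j
      rw [Finset.mul_sum, Finset.mul_sum]
      refine Finset.sum_congr rfl fun l _ => ?_
      rw [show j * (l - i) = -(i * j) + j * l by ring, AddChar.map_add_eq_mul, C_mul]
      ring
    simp only [this]
    rw [Finset.sum_comm]
    simp only [← Finset.sum_mul, ← map_sum, hsum, sub_eq_zero]
    rw [Finset.sum_eq_single i]
    · rw [if_pos rfl, ← mul_assoc, ← C_mul, ZMod.card, mul_inv_cancel₀ hn0, C_1, one_mul]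
    · intro b _ hb; rw [if_neg hb]; simp
    · simp
  · intro j
    simp only [AlgEquiv.ofAlgHom_apply, φ, aeval_X, map_sum, Derivation.leibniz, hd, smul_eq_mul,
      derivation_C, mul_zero, add_zero]
    rw [Finset.mul_sum]
    refine Fintype.sum_equiv (Equiv.addRight 1) _ _ fun i => ?_
    simp only [Equiv.coe_addRight]
    rw [← mul_assoc, ← C_mul, ← AddChar.map_add_eq_mul]
    congr 3; ring

lemma diag_backward {k : Type*} [Field k] [CharZero k] (p s n m : ℕ) (hp : p.Prime)
    (hn : n = p ^ (s + 1)) (hm : m = p ^ s) [NeZero n]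
    (ε : k) (hε : IsPrimitiveRoot ε n)
    (D : Derivation k (MvPolynomial (ZMod n) k) (MvPolynomial (ZMod n) k))
    (hD : ∀ j, D (X j) = C (AddChar.zmodChar n hε.pow_eq_one j) * X j) :
    ∃ (r : ℕ) (f : Fin r → MvPolynomial (ZMod n) k),
        AlgebraicIndependent k f ∧
        {F : MvPolynomial (ZMod n) k | D F = 0} =
          ↑(Algebra.adjoin k (Set.range f)) := by
  classical
  have hnm : n = m * p := by rw [hn, hm, pow_succ]
  have hm0 : 0 < m := hm ▸ pow_pos hp.pos s
  have hlt : ∀ (c : Fin m) (i : Fin p), (c : ℕ) + m * i < n := by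
    intro c i
    have h1 := c.2
    have h2 : m * (i + 1) ≤ m * p := Nat.mul_le_mul_left _ i.2
    rw [mul_add, mul_one] at h2
    omega
  let f : Fin m → MvPolynomial (ZMod n) k :=
    fun c => ∏ i : Fin p, X (((c : ℕ) + m * (i : ℕ) : ℕ) : ZMod n)
  refine ⟨m, f, ?_, ?_⟩
  · let g : MvPolynomial (ZMod n) k →ₐ[k] MvPolynomial (Fin m) k :=
      aeval fun j => if h : j.val < m then X ⟨j.val, h⟩ else 1
    have hgf : ∀ c, g (f c) = X c := by
      intro c
      simp only [f, map_prod, g, aeval_X]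
      rw [Finset.prod_eq_single (⟨0, hp.pos⟩ : Fin p)]
      · have := ZMod.val_cast_of_lt (hlt c ⟨0, hp.pos⟩)
        simp only [mul_zero, add_zero] at this ⊢
        simp only [this, c.2, dif_pos]
      · intro i _ hi
        rw [ZMod.val_cast_of_lt (hlt c i), dif_neg]
        have : 1 ≤ (i : ℕ) := by
          rcases Nat.eq_zero_or_pos (i : ℕ) with h | h
          · exact absurd (Fin.ext h) hi
          · exact h
        have : m * 1 ≤ m * i := Nat.mul_le_mul_left _ this
        omega
      · simp
    have hcomp : g.comp (aeval f) = AlgHom.id k _ := by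
      ext1 c
      simp [hgf]
    apply Function.LeftInverse.injective (g := g)
    intro x
    exact DFunLike.congr_fun hcomp x
  · ext F
    simp only [Set.mem_ofPred_eq, SetLike.mem_coe]
    constructor
    · intro hF
      rw [F.as_sum]
      refine Subalgebra.sum_mem _ fun α hα => ?_
      have h0 : ∑ j, (α j : k) * AddChar.zmodChar n hε.pow_eq_one j = 0 := by
        have := D_coeff _ D hD F α
        rw [hF, coeff_zero] at this
        exact (mul_eq_zero.1 this.symm).resolve_right (mem_support_iff.1 hα)
      let E : Fin p × Fin m ≃ ZMod n :=
        finProdFinEquiv.trans ((finCongr (by rw [hnm, mul_comm])).trans (ZMod.finEquiv n).toEquiv)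
      have hval : ∀ (N : ℕ) [NeZero N] (x : Fin N), ZMod.finEquiv N x = ((x : ℕ) : ZMod N) := by
        intro N _ x
        cases N with
        | zero => exact x.elim0
        | succ N => exact (ZMod.natCast_zmod_val (n := N + 1) x).symm
      have hE : ∀ x, E x = (((x.2 : ℕ) + m * (x.1 : ℕ) : ℕ) : ZMod n) := by
        intro x
        simp only [E, Equiv.trans_apply]
        exact hval n _
      have hstep : ∀ j, j + m < n → α ((j + m : ℕ) : ZMod n) = α (j : ZMod n) := by
        intro j hj
        have := cyc_aux p s hp ε (hn ▸ hε) (fun j => (α (j : ZMod n) : ℤ)) ?_ j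
          (by rw [← hn, ← hm]; exact hj)
        · rw [← hm] at this
          exact_mod_cast this
        · rw [← hn, ← h0, Finset.sum_range]
          refine Fintype.sum_equiv (ZMod.finEquiv n).toEquiv _ _ fun x => ?_
          have : (ZMod.finEquiv n).toEquiv x = ((x : ℕ) : ZMod n) := hval n x
          rw [this, AddChar.zmodChar_apply']
          simp
      have hconst : ∀ (c : ℕ) (i : ℕ), c + m * i < n →
          α ((c + m * i : ℕ) : ZMod n) = α (c : ZMod n) := by
        intro c i
        induction i with
        | zero => simp
        | succ i ih =>
          intro h
          rw [mul_add, mul_one, ← add_assoc] at h ⊢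
          rw [hstep _ h, ih (by omega)]
      have hmon : monomial α (coeff α F) =
          C (coeff α F) * ∏ c : Fin m, f c ^ (α ((c : ℕ) : ZMod n)) := by
        rw [monomial_eq, Finsupp.prod_fintype _ _ (by simp), ← E.prod_comp,
          Fintype.prod_prod_type_right]
        congr 1
        refine Finset.prod_congr rfl fun c _ => ?_
        simp only [f]
        rw [← Finset.prod_pow]
        refine Finset.prod_congr rfl fun i _ => ?_
        rw [hE, hconst _ _ (hlt c i)]
      rw [hmon]
      refine Subalgebra.mul_mem _ (Subalgebra.algebraMap_mem _ _) ?_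
      refine Subalgebra.prod_mem _ fun c _ => Subalgebra.pow_mem _ ?_ _
      exact Algebra.subset_adjoin ⟨c, rfl⟩
    · intro hF
      induction hF using Algebra.adjoin_induction with
      | mem x hx =>
        obtain ⟨c, rfl⟩ := hx
        simp only [f]
        rw [D_prod _ D hD]
        have : ∑ i : Fin p, AddChar.zmodChar n hε.pow_eq_one
            (((c : ℕ) + m * (i : ℕ) : ℕ) : ZMod n) = 0 := by
          simp only [AddChar.zmodChar_apply', pow_add, pow_mul]
          rw [← Finset.mul_sum, ← Finset.sum_range (fun i => (ε ^ m) ^ i)]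
          rw [(hε.pow (Nat.pos_of_ne_zero (NeZero.ne n)) hnm).geom_sum_eq_zero hp.one_lt, mul_zero]
        rw [this]; simp
      | algebraMap r => simp
      | add x y _ _ hx hy => simp [hx, hy]
      | mul x y _ _ hx hy => simp [hx, hy]

lemma diag_forward {k : Type*} [Field k] [CharZero k] (n : ℕ) [NeZero n] (hn : 3 ≤ n)
    (ε : k) (hε : IsPrimitiveRoot ε n)
    (D : Derivation k (MvPolynomial (ZMod n) k) (MvPolynomial (ZMod n) k))
    (hD : ∀ j, D (X j) = C (AddChar.zmodChar n hε.pow_eq_one j) * X j)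
    (r : ℕ) (f : Fin r → MvPolynomial (ZMod n) k)
    (hf : AlgebraicIndependent k f)
    (hA : {F : MvPolynomial (ZMod n) k | D F = 0} =
          ↑(Algebra.adjoin k (Set.range f))) : IsPrimePow n := by
  classical
  set A := Algebra.adjoin k (Set.range f) with hAdef
  have hmem : ∀ F, F ∈ A ↔ D F = 0 := by
    intro F
    have := Set.ext_iff.1 hA F
    simpa using this.symm
  have hufm : UniqueFactorizationMonoid A :=
    hf.aevalEquiv.toMulEquiv.uniqueFactorizationMonoid inferInstance
  by_contra hpp
  obtain ⟨p, q, hp, hq, hpn, hqn, hpq⟩ : ∃ p q : ℕ, p.Prime ∧ q.Prime ∧ p ∣ n ∧ q ∣ n ∧ p ≠ q := by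
    rw [isPrimePow_iff_unique_prime_dvd] at hpp
    by_contra hcon
    push Not at hcon
    apply hpp
    obtain ⟨p, hp, hpn⟩ := Nat.exists_prime_and_dvd (n := n) (by omega)
    exact ⟨p, ⟨hp, hpn⟩, fun q hq => hcon q p hq.1 hp hq.2 hpn⟩
  obtain ⟨a, ha⟩ := hpn
  obtain ⟨b, hb⟩ := hqn
  have hn0 : 0 < n := by omega
  have hεp : IsPrimitiveRoot (ε ^ a) p := hε.pow hn0 (by rw [ha, mul_comm])
  have hεq : IsPrimitiveRoot (ε ^ b) q := hε.pow hn0 (by rw [hb, mul_comm])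
  have h1 : ∀ j, (∏ i ∈ Finset.range p, X ((a * i + b * j : ℕ) : ZMod n)) ∈ A := by
    intro j
    rw [hmem, D_prod _ D hD]
    simp only [AddChar.zmodChar_apply', pow_add, pow_mul]
    rw [← Finset.sum_mul, hεp.geom_sum_eq_zero hp.one_lt]
    simp
  have h2 : ∀ i, (∏ j ∈ Finset.range q, X ((a * i + b * j : ℕ) : ZMod n)) ∈ A := by
    intro i
    rw [hmem, D_prod _ D hD]
    simp only [AddChar.zmodChar_apply', pow_add, pow_mul]
    rw [← Finset.mul_sum, hεq.geom_sum_eq_zero hq.one_lt]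
    simp
  let w : ℕ → A := fun j => ⟨_, h1 j⟩
  let v : ℕ → A := fun i => ⟨_, h2 i⟩
  have hwv : ∏ j ∈ Finset.range q, w j = ∏ i ∈ Finset.range p, v i := by
    apply Subtype.ext
    simp only [SubmonoidClass.coe_finsetProd, w, v]
    exact Finset.prod_comm
  have hX0 : ∀ i < p, (X ((a * i : ℕ) : ZMod n) : MvPolynomial (ZMod n) k) ∣ (w 0 : MvPolynomial (ZMod n) k) := by
    intro i hi
    have := Finset.dvd_prod_of_mem (fun i => (X ((a * i + b * 0 : ℕ) : ZMod n) : MvPolynomial (ZMod n) k))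
      (Finset.mem_range.2 hi)
    simpa [w] using this
  have hunitC : ∀ x : A, IsUnit (x : MvPolynomial (ZMod n) k) → IsUnit x := by
    intro x hx
    obtain ⟨c, hc, hxc⟩ := isUnit_iff_eq_C_of_isReduced.1 hx
    have : x = algebraMap k A c := Subtype.ext (by simpa [algebraMap_eq] using hxc)
    rw [this]
    exact hc.map _
  have hirr : Irreducible (w 0) := by
    constructor
    · intro hu
      have hu' : IsUnit ((w 0 : A) : MvPolynomial (ZMod n) k) := hu.map A.val
      exact (X_prime (R := k)).not_isUnit (isUnit_of_dvd_unit (hX0 0 hp.pos) hu')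
    · intro x y hxy
      have hxy' : (x : MvPolynomial (ZMod n) k) * (y : MvPolynomial (ZMod n) k) =
          1 * ∏ i ∈ Finset.range p, X ((a * i + b * 0 : ℕ) : ZMod n) := by
        rw [one_mul]
        exact (congrArg Subtype.val hxy).symm
      obtain ⟨t, u, c, c', htu, hdisj, hcc, hx, hy⟩ :=
        mul_eq_mul_prime_prod (fun i _ => X_prime) hxy'
      have hcu : IsUnit c := IsUnit.of_mul_eq_one _ hcc.symm
      have hcu' : IsUnit c' := IsUnit.of_mul_eq_one _ ((mul_comm _ _).trans hcc.symm)
      obtain ⟨r, hr, rfl⟩ := isUnit_iff_eq_C_of_isReduced.1 hcu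
      have hDx : D x = 0 := (hmem _).1 x.2
      rw [hx, Derivation.leibniz, D_prod _ D hD, derivation_C, smul_zero, add_zero, smul_eq_mul] at hDx
      have hprod0 : (∏ i ∈ t, X ((a * i + b * 0 : ℕ) : ZMod n) : MvPolynomial (ZMod n) k) ≠ 0 :=
        Finset.prod_ne_zero_iff.2 fun i _ => X_ne_zero _
      have hsum := (mul_eq_zero.1 ((mul_eq_zero.1 hDx).resolve_left hcu.ne_zero)).resolve_right hprod0
      rw [C_eq_zero] at hsum
      simp only [AddChar.zmodChar_apply', mul_zero, add_zero, pow_mul] at hsum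
      have htsub : t ⊆ Finset.range p := htu ▸ Finset.subset_union_left
      have hcyc := cyc_aux p 0 hp (ε ^ a) (by simpa using hεp)
        (fun i => if i ∈ t then 1 else 0) (by
          rw [← hsum]
          simp only [Int.cast_ite, Int.cast_one, Int.cast_zero, ite_mul, one_mul, zero_mul]
          rw [← Finset.sum_filter, Finset.filter_mem_eq_inter]
          congr 1
          simpa using htsub)
      have hall : ∀ i < p, (i ∈ t ↔ 0 ∈ t) := by
        intro i
        induction i with
        | zero => simp
        | succ i ih =>
          intro hi
          rw [← ih (by omega)]
          have := hcyc i (by simpa using hi)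
          simp only [pow_zero] at this
          by_cases h1 : i ∈ t <;> by_cases h2 : i + 1 ∈ t <;> simp_all
      by_cases h0 : 0 ∈ t
      · right
        apply hunitC
        have : u = ∅ := by
          rw [Finset.eq_empty_iff_forall_notMem]
          intro i hi
          have hip : i ∈ Finset.range p := htu ▸ Finset.mem_union_right _ hi
          exact Finset.disjoint_left.1 hdisj ((hall i (Finset.mem_range.1 hip)).2 h0) hi
        rw [hy, this]; simpa using hcu'
      · left
        apply hunitC
        have : t = ∅ := by
          rw [Finset.eq_empty_iff_forall_notMem]
          intro i hi
          exact h0 ((hall i (Finset.mem_range.1 (htsub hi))).1 hi)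
        rw [hx, this]; simpa using hcu
  have hprime : Prime (w 0) := UniqueFactorizationMonoid.irreducible_iff_prime.1 hirr
  have hdvd : w 0 ∣ ∏ i ∈ Finset.range p, v i := by
    rw [← hwv]
    exact Finset.dvd_prod_of_mem w (Finset.mem_range.2 hq.pos)
  obtain ⟨i, hi, hdi⟩ := (hprime.dvd_finsetProd_iff _).1 hdvd
  have hdi' : ((w 0 : A) : MvPolynomial (ZMod n) k) ∣ v i := map_dvd A.val hdi
  have hloc : ∀ l < p, ∃ j, ((a * l : ℕ) : ZMod n) = ((a * i + b * j : ℕ) : ZMod n) := by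
    intro l hl
    have h3 := (hX0 l hl).trans hdi'
    simp only [v] at h3
    obtain ⟨j, _, hj⟩ := ((X_prime (R := k)).dvd_finsetProd_iff _).1 h3
    exact ⟨j, X_dvd_X.1 hj⟩
  obtain ⟨j0, hj0⟩ := hloc 0 hp.pos
  obtain ⟨j1, hj1⟩ := hloc 1 hp.one_lt
  have hbq : (b : ZMod n) * q = 0 := by
    rw [← Nat.cast_mul, mul_comm, ← hb, ZMod.natCast_self]
  have haq : ((a * q : ℕ) : ZMod n) = 0 := by
    push_cast at hj0 hj1 ⊢
    linear_combination (q : ZMod n) * hj1 - q * hj0 + (j1 - j0) * hbq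
  rw [ZMod.natCast_eq_zero_iff, ha, mul_comm p a] at haq
  have ha0 : 0 < a := by
    rcases Nat.eq_zero_or_pos a with h | h
    · simp [h] at ha; omega
    · exact h
  have := Nat.dvd_of_mul_dvd_mul_left ha0 haq
  exact hpq ((Nat.prime_dvd_prime_iff_eq hp hq).1 this)

/-- The ring of constants `k[X]^d` of the cyclotomic derivation is a
polynomial ring over `k` (i.e. it is generated, as a `k`-algebra, by finitely many
algebraically independent elements) if and only if `n` is a power of a prime number. -/
theorem stmt_15 {k : Type*} [Field k] [CharZero k] (n : ℕ) (hn : 3 ≤ n)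
    (ε : k) (hε : IsPrimitiveRoot ε n)
    (d : Derivation k (MvPolynomial (ZMod n) k) (MvPolynomial (ZMod n) k))
    (hd : ∀ j : ZMod n, d (X j) = X (j + 1)) :
    (∃ (s : ℕ) (f : Fin s → MvPolynomial (ZMod n) k),
        AlgebraicIndependent k f ∧
        {F : MvPolynomial (ZMod n) k | d F = 0} = ↑(Algebra.adjoin k (Set.range f)))
      ↔ IsPrimePow n := by
  have : NeZero n := ⟨by omega⟩
  obtain ⟨φ, hφ⟩ := phi_exists n ε hε d hd
  let D : Derivation k (MvPolynomial (ZMod n) k) (MvPolynomial (ZMod n) k) :=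
    mkDerivation k fun j => C (AddChar.zmodChar n hε.pow_eq_one j) * X j
  have hD : ∀ j, D (X j) = C (AddChar.zmodChar n hε.pow_eq_one j) * X j :=
    fun j => mkDerivation_X _ _ _
  have hconj : ∀ F, d (φ F) = φ (D F) := by
    intro F
    induction F using MvPolynomial.induction_on with
    | C a =>
      have : φ (C a) = C a := φ.commutes a
      rw [this, derivation_C, derivation_C, map_zero]
    | add p q hp hq => simp only [map_add, hp, hq]
    | mul_X p j hp =>
      have : ∀ a, φ (C a) = C a := φ.commutes
      rw [map_mul, Derivation.leibniz, Derivation.leibniz, hp, hφ, hD]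
      simp only [smul_eq_mul, map_add, map_mul, this]
  have hker : ∀ F, D F = 0 ↔ d (φ F) = 0 := by
    intro F; rw [hconj, map_eq_zero_iff _ φ.injective]
  constructor
  · rintro ⟨r, f, hf, hA⟩
    refine diag_forward n hn ε hε D hD r (φ.symm ∘ f)
      (hf.map' (f := φ.symm.toAlgHom) φ.symm.injective) ?_
    have := AlgHom.map_adjoin φ.symm.toAlgHom (Set.range f)
    rw [Set.range_comp]
    change _ = SetLike.coe (Algebra.adjoin k (φ.symm.toAlgHom '' Set.range f))
    rw [← this]
    ext F
    rw [Subalgebra.coe_map, ← hA]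
    simp only [Set.mem_ofPred_eq, Set.mem_image, hker]
    constructor
    · intro h; exact ⟨φ F, h, φ.symm_apply_apply F⟩
    · rintro ⟨G, hG, rfl⟩
      have : φ (φ.symm.toAlgHom G) = G := φ.apply_symm_apply G
      rw [this]; exact hG
  · intro h
    obtain ⟨p, s, hp, hs, rfl⟩ := (isPrimePow_nat_iff _).1 h
    obtain ⟨s, rfl⟩ : ∃ t, s = t + 1 := ⟨s - 1, by omega⟩
    obtain ⟨r, f, hf, hA⟩ := diag_backward p s _ _ hp rfl rfl ε hε D hD
    refine ⟨r, φ ∘ f, hf.map' (f := φ.toAlgHom) φ.injective, ?_⟩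
    have := AlgHom.map_adjoin φ.toAlgHom (Set.range f)
    rw [Set.range_comp]
    change _ = SetLike.coe (Algebra.adjoin k (φ.toAlgHom '' Set.range f))
    rw [← this]
    ext F
    rw [Subalgebra.coe_map, ← hA]
    simp only [Set.mem_ofPred_eq, Set.mem_image, hker]
    constructor
    · intro h; exact ⟨φ.symm F, by simpa using h, φ.apply_symm_apply F⟩
    · rintro ⟨G, hG, rfl⟩
      exact hG
end

section
/- The ring of constants of Δ satisfies k[Y]^Δ = k[v], where v = y_0 y_1 ⋯ y_{n−1}: a polynomial F ∈ k[Y] satisfies Δ(F) = 0 if and only if F is a polynomial in the product v with coefficients in k. -/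
open MvPolynomial

/-- `Δ` acts on a monomial by multiplication with a linear form. -/
theorem delta_monomial_aux {k : Type*} [Field k] (n : ℕ) [NeZero n]
    (Δ : Derivation k (MvPolynomial (ZMod n) k) (MvPolynomial (ZMod n) k))
    (hΔ : ∀ j : ZMod n, Δ (X j) = X j * (X (j + 1) - X j)) (b : ZMod n →₀ ℕ) :
    Δ (monomial b 1) = monomial b 1 * ∑ i : ZMod n, (b i : MvPolynomial (ZMod n) k) * (X (i + 1) - X i) := by
  induction b using Finsupp.induction_linear with
  | zero => simp
  | add f g hf hg =>
    have h : (monomial (f + g) (1 : k)) = monomial f 1 * monomial g 1 := by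
      rw [monomial_mul, one_mul]
    rw [h, Derivation.leibniz, hf, hg]
    simp only [Finsupp.add_apply, Nat.cast_add, add_mul, Finset.sum_add_distrib, smul_eq_mul]
    ring
  | single i m =>
    have h : (monomial (Finsupp.single i m) (1 : k)) = X i ^ m := by
      rw [X_pow_eq_monomial]
    rw [h, Derivation.leibniz_pow, hΔ, Finset.sum_eq_single i]
    · rcases m with _ | m
      · simp
      · simp [pow_succ]
        ring
    · intro j _ hj
      simp [Ne.symm hj]
    · simp

theorem delta_monomial {k : Type*} [Field k] (n : ℕ) [NeZero n]
    (Δ : Derivation k (MvPolynomial (ZMod n) k) (MvPolynomial (ZMod n) k))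
    (hΔ : ∀ j : ZMod n, Δ (X j) = X j * (X (j + 1) - X j)) (b : ZMod n →₀ ℕ) (c : k) :
    Δ (monomial b c) = ∑ i : ZMod n,
      monomial (b + Finsupp.single i 1) (c * ((b (i - 1) : k) - (b i : k))) := by
  have h : monomial b c = c • monomial b (1 : k) := by simp [smul_monomial]
  rw [h, Derivation.map_smul, delta_monomial_aux n Δ hΔ]
  have h2 : ∑ i : ZMod n, (b i : MvPolynomial (ZMod n) k) * (X (i + 1) - X i)
      = ∑ i : ZMod n, (C ((b (i - 1) : k) - (b i : k))) * X i := by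
    simp only [mul_sub, C_sub, sub_mul, Finset.sum_sub_distrib]
    congr 1
    · rw [← Equiv.sum_comp (Equiv.addRight (1 : ZMod n))
        (fun i => (C (b (i - 1) : k)) * X i)]
      simp
  rw [h2, Finset.mul_sum, Finset.smul_sum]
  refine Finset.sum_congr rfl fun i _ => ?_
  rw [C_mul_X_eq_monomial, monomial_mul, smul_monomial]
  simp

theorem coeff_delta {k : Type*} [Field k] (n : ℕ) [NeZero n]
    (Δ : Derivation k (MvPolynomial (ZMod n) k) (MvPolynomial (ZMod n) k))
    (hΔ : ∀ j : ZMod n, Δ (X j) = X j * (X (j + 1) - X j)) (F : MvPolynomial (ZMod n) k)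
    (m : ZMod n →₀ ℕ) :
    coeff m (Δ F) = ∑ b ∈ F.support, ∑ i : ZMod n,
      if b + Finsupp.single i 1 = m then coeff b F * ((b (i - 1) : k) - (b i : k)) else 0 := by
  conv_lhs => rw [F.as_sum]
  rw [map_sum, coeff_sum]
  refine Finset.sum_congr rfl fun b _ => ?_
  rw [delta_monomial n Δ hΔ, coeff_sum]
  simp only [coeff_monomial]

theorem support_mono {k : Type*} [Field k] [CharZero k] (n : ℕ) (hn : 3 ≤ n) [NeZero n]
    (Δ : Derivation k (MvPolynomial (ZMod n) k) (MvPolynomial (ZMod n) k))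
    (hΔ : ∀ j : ZMod n, Δ (X j) = X j * (X (j + 1) - X j)) (F : MvPolynomial (ZMod n) k)
    (hF : Δ F = 0) (j : ZMod n) (b : ZMod n →₀ ℕ) (hb : b ∈ F.support) :
    b j ≤ b (j - 1) := by
  have : Fact (1 < n) := ⟨by omega⟩
  have hj1 : j - 1 ≠ j := by simp
  obtain ⟨a, ha, hmin⟩ := F.support.exists_min_image
    (fun b => (b (j - 1) : ℤ) - (b j : ℤ)) ⟨b, hb⟩
  by_contra hlt
  have hneg : (a (j - 1) : ℤ) - (a j : ℤ) < 0 := by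
    have := hmin b hb
    omega
  have h := coeff_delta n Δ hΔ F (a + Finsupp.single j 1)
  -- only one pair can contribute to this coefficient
  have key : ∀ b ∈ F.support, ∀ i : ZMod n,
      b + Finsupp.single i 1 = a + Finsupp.single j 1 → i = j := by
    intro b hb i hi
    by_contra hij
    have e1 := DFunLike.congr_fun hi j
    have e2 := DFunLike.congr_fun hi (j - 1)
    simp only [Finsupp.add_apply, Finsupp.single_apply, if_neg hij, if_neg (Ne.symm hj1),
      if_true] at e1 e2
    have := hmin b hb
    split_ifs at e2 <;> omega
  rw [hF, coeff_zero, Finset.sum_eq_single a, Finset.sum_eq_single j] at h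
  · rw [if_pos rfl] at h
    rcases mul_eq_zero.mp h.symm with h | h
    · exact (mem_support_iff.mp ha) h
    · have : a (j - 1) = a j := by exact_mod_cast sub_eq_zero.mp h
      omega
  · intro i _ hi
    rw [if_neg]
    exact fun h => hi (key a ha i h)
  · simp
  · intro b hb hba
    refine Finset.sum_eq_zero fun i _ => ?_
    rw [if_neg]
    intro h
    have := key b hb i h
    subst this
    exact hba (add_right_cancel h)
  · exact fun h => absurd ha h

theorem prod_pow_eq {k : Type*} [Field k] (n : ℕ) [NeZero n] (b : ZMod n →₀ ℕ) (t : ℕ)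
    (hb : ∀ i, b i = t) :
    monomial b (1 : k) = (∏ i : ZMod n, X i) ^ t := by
  rw [monomial_eq, C_1, one_mul, Finsupp.prod_fintype _ _ (by simp), ← Finset.prod_pow]
  simp [hb]

/-- The ring of constants of the factorisable derivation `Δ` of
`k[y_0,…,y_{n-1}]` (with `Δ(y_j) = y_j(y_{j+1} - y_j)`, indices mod `n`) is `k[v]`, where
`v = y_0 y_1 ⋯ y_{n-1}`: a polynomial `F` satisfies `Δ(F) = 0` iff `F` is a polynomial in
`v` with coefficients in `k`. -/
theorem stmt_18 {k : Type*} [Field k] [CharZero k] (n : ℕ) (hn : 3 ≤ n) [NeZero n]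
    (Δ : Derivation k (MvPolynomial (ZMod n) k) (MvPolynomial (ZMod n) k))
    (hΔ : ∀ j : ZMod n, Δ (X j) = X j * (X (j + 1) - X j)) :
    {F : MvPolynomial (ZMod n) k | Δ F = 0}
      = ↑(Algebra.adjoin k ({∏ i : ZMod n, X i} : Set (MvPolynomial (ZMod n) k))) := by
  ext F
  simp only [Set.mem_ofPred_eq, SetLike.mem_coe]
  constructor
  · intro hF
    rw [F.as_sum]
    refine Subalgebra.sum_mem _ fun b hb => ?_
    have hmono := fun j => support_mono n hn Δ hΔ F hF j b hb
    have hsucc : ∀ m : ℕ, b ((m : ZMod n)) ≤ b 0 := by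
      intro m
      induction m with
      | zero => simp
      | succ m ih =>
        refine le_trans ?_ ih
        simpa using hmono ((m + 1 : ℕ) : ZMod n)
    have hpred : ∀ m : ℕ, b 0 ≤ b (-(m : ZMod n)) := by
      intro m
      induction m with
      | zero => simp
      | succ m ih =>
        refine le_trans ih ?_
        have := hmono (-(m : ZMod n))
        rwa [show -(m : ZMod n) - 1 = -((m + 1 : ℕ) : ZMod n) by push_cast; ring] at this
    have hconst : ∀ i, b i = b 0 := by
      intro i
      apply le_antisymm
      · simpa using hsucc i.val
      · simpa using hpred (-i).val
    have h : monomial b (coeff b F) = coeff b F • monomial b (1 : k) := by simp [smul_monomial]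
    rw [h, prod_pow_eq n b (b 0) hconst]
    exact Subalgebra.smul_mem _ (Subalgebra.pow_mem _ (Algebra.subset_adjoin (Set.mem_singleton _)) _) _
  · intro hF
    induction hF using Algebra.adjoin_induction with
    | mem x hx =>
      rw [Set.mem_singleton_iff] at hx
      have h := prod_pow_eq (k := k) n (Finsupp.equivFunOnFinite.symm fun _ => 1) 1 (by simp)
      rw [pow_one] at h
      rw [hx, ← h, delta_monomial n Δ hΔ]
      simp
    | algebraMap r => exact Δ.map_algebraMap r
    | add x y _ _ hx hy => rw [map_add, hx, hy, add_zero]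
    | mul x y _ _ hx hy => rw [Derivation.leibniz, hx, hy, smul_zero, smul_zero, add_zero]
end

section
/- If n is a prime number, then the field of constants of Δ on k(Y) satisfies k(Y)^Δ = k(v), where v = y_0 y_1 ⋯ y_{n−1}: a rational function f ∈ k(Y) satisfies Δ(f) = 0 if and only if f ∈ k(v). -/
open MvPolynomial

lemma aux_weights {k : Type*} [Field k] [CharZero k] {n : ℕ} (hp : n.Prime) {ε : k}
    (hε : IsPrimitiveRoot ε n) (a b : Fin n →₀ ℕ) (hd : ∑ i, a i = ∑ i, b i)
    (hw : ∑ i : Fin n, (a i : k) * ε ^ i.val = ∑ i : Fin n, (b i : k) * ε ^ i.val) : a = b := by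
  have h := (hε.sum_eq_zero_iff_forall_eq_int hp (fun i => (a i : ℤ) - b i)).1 (by
    push_cast
    simp only [sub_mul, Finset.sum_sub_distrib, hw, sub_self])
  ext i
  have h1 : ∑ j : Fin n, ((a j : ℤ) - b j) = 0 := by
    rw [Finset.sum_sub_distrib]
    have : ((∑ i, a i : ℕ) : ℤ) = ((∑ i, b i : ℕ) : ℤ) := by rw [hd]
    push_cast at this
    rw [this, sub_self]
  rw [Finset.sum_congr rfl (fun j _ => h j i)] at h1
  simp only [Finset.sum_const, Finset.card_univ, Fintype.card_fin, nsmul_eq_mul, mul_eq_zero,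
    Nat.cast_eq_zero, hp.ne_zero, false_or] at h1
  omega

lemma aux_eigen {k K ι : Type*} [Field k] [AddCommGroup K] [Module k K] (T : Module.End k K)
    (s : Finset ι) (w : ι → k) (hw : ∀ a ∈ s, ∀ b ∈ s, w a = w b → a = b) (z : ι → K)
    (hz : ∀ a ∈ s, T (z a) = w a • z a) (h0 : ∑ a ∈ s, z a = 0) : ∀ a ∈ s, z a = 0 := by
  classical
  by_contra! hcon
  obtain ⟨a, has, ha⟩ := hcon
  let I := {b // b ∈ s.filter (fun b => z b ≠ 0)}
  have hmem : ∀ b : I, b.1 ∈ s ∧ z b.1 ≠ 0 := fun b => Finset.mem_filter.1 b.2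
  have hli := T.eigenvectors_linearIndependent' (ι := I) (fun b => w b.1)
    (fun b c h => Subtype.ext (hw _ (hmem b).1 _ (hmem c).1 h)) (fun b => z b.1)
    (fun b => ⟨Module.End.mem_eigenspace_iff.2 (hz _ (hmem b).1), (hmem b).2⟩)
  rw [Fintype.linearIndependent_iff] at hli
  have := hli (fun _ => 1) (by
    simp only [one_smul]
    exact (Finset.sum_coe_sort (s.filter (fun b => z b ≠ 0)) z).trans
      ((Finset.sum_filter_ne_zero s).trans h0)) ⟨a, by simp [has, ha]⟩
  exact one_ne_zero this

lemma aux_fourier {K : Type*} [Field K] [CharZero K] {n : ℕ} (hn : 0 < n) {e : K}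
    (he : IsPrimitiveRoot e n) (x : ℕ → K) (m : ℕ) (hm : m < n) :
    ∑ i : Fin n, e ^ (i.val * m) * (∑ l ∈ Finset.range n, ((e ^ i.val)⁻¹) ^ l * x l)
      = n * x m := by
  have e0 : e ≠ 0 := he.ne_zero hn.ne'
  rw [Fin.sum_univ_eq_sum_range
    (fun i => e ^ (i * m) * (∑ l ∈ Finset.range n, ((e ^ i)⁻¹) ^ l * x l))]
  simp_rw [Finset.mul_sum]
  rw [Finset.sum_comm]
  rw [Finset.sum_eq_single m]
  · have : ∀ i ∈ Finset.range n, e ^ (i * m) * ((e ^ i)⁻¹ ^ m * x m) = x m := by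
      intro i _
      rw [pow_mul, ← mul_assoc, ← mul_pow, mul_inv_cancel₀ (pow_ne_zero _ e0), one_pow, one_mul]
    rw [Finset.sum_congr rfl this]
    simp
  · intro l hl hlm
    have hl := Finset.mem_range.1 hl
    have : ∀ i ∈ Finset.range n, e ^ (i * m) * ((e ^ i)⁻¹ ^ l * x l)
        = (e ^ m / e ^ l) ^ i * x l := by
      intro i _
      rw [div_pow, ← pow_mul, ← pow_mul, mul_comm i m, inv_pow, ← pow_mul, mul_comm i l]
      field_simp
    rw [Finset.sum_congr rfl this, ← Finset.sum_mul]
    have hr : e ^ m / e ^ l ≠ 1 := by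
      intro h
      rw [div_eq_one_iff_eq (pow_ne_zero _ e0)] at h
      exact hlm (he.pow_inj hl hm h.symm)
    rw [geom_sum_eq hr, div_pow, ← pow_mul, ← pow_mul, mul_comm m, mul_comm l, pow_mul, pow_mul,
      he.pow_eq_one]
    simp
  · intro h
    exact absurd (Finset.mem_range.2 hm) h

lemma aux_core {k K : Type*} [Field k] [CharZero k] [Field K] [CharZero K] [Algebra k K]
    (n : ℕ) [NeZero n] (hp : n.Prime) (ε : k) (hε : IsPrimitiveRoot ε n)
    (D : Derivation ℤ K K) (hD : ∀ c : k, D (algebraMap k K c) = 0)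
    (y : ZMod n → K) (hy0 : ∀ j, y j ≠ 0) (hy : ∀ j, D (y j) = y j * (y (j + 1) - y j))
    (t : K) (ht : t ^ n = ∏ j, y j) (hDt : D t = 0)
    (f : K) (hf : D f = 0) (p q : MvPolynomial (ZMod n) k) (hq : aeval y q ≠ 0)
    (hpq : aeval y p = f * aeval y q) : f ∈ IntermediateField.adjoin k {t} := by
  have hn : 0 < n := hp.pos
  have t0 : t ≠ 0 := by
    rintro rfl
    rw [zero_pow hn.ne'] at ht
    exact Finset.prod_ne_zero_iff.2 (fun j _ => hy0 j) ht.symm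
  set e : K := algebraMap k K ε with he_def
  have he : IsPrimitiveRoot e n := hε.map_of_injective (algebraMap k K).injective
  have e0 : e ≠ 0 := he.ne_zero hn.ne'
  have hDe : D e = 0 := hD ε
  let x : ℕ → K := fun m => ∏ i ∈ Finset.range m, (y (i : ZMod n) / t)
  have x0 : x 0 = 1 := by simp [x]
  have xs : ∀ m, x (m + 1) = x m * (y (m : ZMod n) / t) := fun m => by
    simp only [x, Finset.prod_range_succ]
  have xne : ∀ m, x m ≠ 0 := fun m =>
    Finset.prod_ne_zero_iff.2 (fun i _ => div_ne_zero (hy0 _) t0)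
  have xn : x n = 1 := by
    have h1 : ∏ i ∈ Finset.range n, y (i : ZMod n) = ∏ j, y j := by
      refine Finset.prod_bij' (fun i _ => (i : ZMod n)) (fun j _ => j.val) ?_ ?_ ?_ ?_ ?_
      · simp
      · intro j _; simpa using ZMod.val_lt j
      · intro i hi; simpa using ZMod.val_cast_of_lt (Finset.mem_range.1 hi)
      · intro j _; simp
      · simp
    simp only [x, Finset.prod_div_distrib, h1, Finset.prod_const, Finset.card_range, ← ht]
    exact div_self (pow_ne_zero _ t0)
  have Dx : ∀ m, D (x m) = t * x (m + 1) - y 0 * x m := by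
    intro m
    induction m with
    | zero =>
      rw [xs, x0, D.map_one_eq_zero]
      simp only [Nat.cast_zero]
      field_simp
      ring
    | succ m ih =>
      rw [xs (m + 1), xs m, Derivation.leibniz, ih, Derivation.leibniz_div_const _ _ _ hDt, hy, xs m]
      simp only [smul_eq_mul]
      push_cast
      field_simp
      ring
  let c : Fin n → K := fun i => ∑ l ∈ Finset.range n, ((e ^ i.val)⁻¹) ^ l * x l
  have Dc : ∀ i, D (c i) = (t * e ^ i.val - y 0) * c i := by
    intro i
    have hDei : D ((e ^ i.val)⁻¹) = 0 := by
      rw [Derivation.leibniz_inv, Derivation.leibniz_pow, hDe]; simp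
    have h1 : D (c i) = ∑ l ∈ Finset.range n, ((e ^ i.val)⁻¹) ^ l * (t * x (l + 1) - y 0 * x l) := by
      simp only [c, map_sum]
      refine Finset.sum_congr rfl fun l _ => ?_
      rw [Derivation.leibniz, Derivation.leibniz_pow, hDei, Dx]
      simp
    have h2 : ∑ l ∈ Finset.range n, ((e ^ i.val)⁻¹) ^ (l + 1) * x (l + 1) = c i := by
      have h3 := Finset.sum_range_succ (fun l => ((e ^ i.val)⁻¹) ^ l * x l) n
      rw [Finset.sum_range_succ'] at h3
      have h4 : ((e ^ i.val)⁻¹) ^ n = 1 := by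
        rw [inv_pow, ← pow_mul, mul_comm, pow_mul, he.pow_eq_one, one_pow, inv_one]
      rw [xn, h4, x0, pow_zero] at h3
      exact add_right_cancel h3
    rw [h1, sub_mul]
    nth_rewrite 1 [← h2]
    simp only [c, Finset.mul_sum]
    rw [← Finset.sum_sub_distrib]
    refine Finset.sum_congr rfl fun l _ => ?_
    have : e ^ i.val ≠ 0 := pow_ne_zero _ e0
    rw [pow_succ]
    field_simp
  let k' := IntermediateField.adjoin k {t}
  let V : ℕ → K → Prop := fun N z => ∃ P : MvPolynomial (Fin n) k', P.IsHomogeneous N ∧ aeval c P = z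
  have Vadd : ∀ N z w, V N z → V N w → V N (z + w) := by
    rintro N _ _ ⟨P, hP, rfl⟩ ⟨Q, hQ, rfl⟩
    exact ⟨P + Q, hP.add hQ, map_add _ _ _⟩
  have Vmul : ∀ N M z w, V N z → V M w → V (N + M) (z * w) := by
    rintro N M _ _ ⟨P, hP, rfl⟩ ⟨Q, hQ, rfl⟩
    exact ⟨P * Q, hP.mul hQ, map_mul _ _ _⟩
  have Vconst : ∀ a : k', V 0 (a : K) := fun a =>
    ⟨C a, isHomogeneous_C _ _, by simp⟩
  have hk : ∀ a : k, algebraMap k K a ∈ k' := fun a => k'.algebraMap_mem a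
  have Vx' : ∀ m, m < n → V 1 (x m) := by
    intro m hm
    refine ⟨C (⟨algebraMap k K (n : k)⁻¹, hk _⟩ : k') *
      ∑ i : Fin n, C (⟨algebraMap k K (ε ^ (i.val * m)), hk _⟩ : k') * X i, ?_, ?_⟩
    · rw [← zero_add 1]
      refine (isHomogeneous_C _ _).mul (IsHomogeneous.sum _ _ _ fun i _ => ?_)
      rw [← zero_add 1]
      exact (isHomogeneous_C _ _).mul (isHomogeneous_X _ _)
    · have := aux_fourier hn he x m hm
      simp only [map_mul, map_sum, aeval_X, aeval_C, IntermediateField.algebraMap_apply]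
      simp only [map_pow, map_inv₀, map_natCast]
      rw [inv_mul_eq_iff_eq_mul₀ (Nat.cast_ne_zero.2 hn.ne')]
      exact this
  have Vx : ∀ m, m ≤ n → V 1 (x m) := by
    intro m hm
    rcases hm.lt_or_eq with h | h
    · exact Vx' m h
    · rw [h, xn, ← x0]; exact Vx' 0 hn
  let W : K := ∏ m ∈ Finset.range n, x m
  have W0 : W ≠ 0 := Finset.prod_ne_zero_iff.2 fun m _ => xne m
  have Vprod : ∀ s : Finset ℕ, s ⊆ Finset.range n → V s.card (∏ m ∈ s, x m) := by
    classical
    intro s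
    induction s using Finset.induction_on with
    | empty => intro _; simpa using Vconst 1
    | insert a s ha ih =>
      intro h
      rw [Finset.prod_insert ha, Finset.card_insert_of_notMem ha, add_comm]
      exact Vmul _ _ _ _ (Vx _ (Finset.mem_range.1 (h (Finset.mem_insert_self _ _))).le)
        (ih fun b hb => h (Finset.mem_insert_of_mem hb))
  have VW : V n W := by simpa using Vprod _ (Finset.Subset.refl _)
  have VyW : ∀ j, V n (y j * W) := by
    classical
    intro j
    have hj : j.val ∈ Finset.range n := Finset.mem_range.2 (ZMod.val_lt j)
    have h1 : y j * W = (t * x (j.val + 1)) * ∏ m ∈ (Finset.range n).erase j.val, x m := by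
      simp only [W]
      rw [← Finset.mul_prod_erase _ _ hj, xs, ZMod.natCast_zmod_val]
      field_simp
    have h2 := Vmul _ _ _ _ (Vmul _ _ _ _ (Vconst ⟨t, IntermediateField.mem_adjoin_simple_self k t⟩)
      (Vx (j.val + 1) (ZMod.val_lt j))) (Vprod _ (Finset.erase_subset j.val (Finset.range n)))
    rw [h1]
    convert h2 using 1
    rw [Finset.card_erase_of_mem hj, Finset.card_range]
    omega
  have VWpow : ∀ M, V (M * n) (W ^ M) := by
    intro M
    induction M with
    | zero => simpa using Vconst 1
    | succ M ih => rw [pow_succ, Nat.succ_mul]; exact Vmul _ _ _ _ ih VW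
  have Vpoly : ∀ r : MvPolynomial (ZMod n) k, ∃ M, ∀ M' ≥ M, V (M' * n) (aeval y r * W ^ M') := by
    intro r
    induction r using MvPolynomial.induction_on with
    | C a =>
      refine ⟨0, fun M' _ => ?_⟩
      have := Vmul _ _ _ _ (Vconst ⟨_, hk a⟩) (VWpow M')
      simpa using this
    | add r s hr hs =>
      obtain ⟨M, hM⟩ := hr
      obtain ⟨M₁, hM₁⟩ := hs
      refine ⟨max M M₁, fun M' h => ?_⟩
      rw [map_add, add_mul]
      exact Vadd _ _ _ (hM _ (le_trans (le_max_left _ _) h)) (hM₁ _ (le_trans (le_max_right _ _) h))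
    | mul_X r j hr =>
      obtain ⟨M, hM⟩ := hr
      refine ⟨M + 1, fun M' h => ?_⟩
      obtain ⟨M', rfl⟩ : ∃ m, M' = m + 1 := ⟨M' - 1, by omega⟩
      have := Vmul _ _ _ _ (hM M' (by omega)) (VyW j)
      rw [Nat.succ_mul]
      convert this using 1
      rw [map_mul, aeval_X]
      ring
  obtain ⟨M₁, h₁⟩ := Vpoly p
  obtain ⟨M₂, h₂⟩ := Vpoly q
  obtain ⟨P, hP, hP'⟩ := h₁ (max M₁ M₂) (le_max_left _ _)
  obtain ⟨Q, hQ, hQ'⟩ := h₂ (max M₁ M₂) (le_max_right _ _)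
  generalize max M₁ M₂ = M at *
  generalize M * n = N at *
  have hDk' : ∀ a : k', D (a : K) = 0 := by
    intro a
    refine IntermediateField.adjoin_induction (F := k) (s := {t}) (p := fun z _ => D z = 0)
      ?_ hD ?_ ?_ ?_ a.2
    · rintro z rfl; exact hDt
    · intro z w _ _ hz hw; rw [map_add, hz, hw, add_zero]
    · intro z _ hz; rw [Derivation.leibniz_inv, hz, smul_zero]
    · intro z w _ _ hz hw; rw [Derivation.leibniz, hz, hw, smul_zero, smul_zero, add_zero]
  classical
  let s := P.support ∪ Q.support
  let mon : (Fin n →₀ ℕ) → K := fun a => ∏ i, c i ^ a i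
  have Dmon : ∀ a : Fin n →₀ ℕ, D (mon a) =
      (t * (∑ i, (a i : K) * e ^ i.val) - (∑ i, a i : ℕ) * y 0) * mon a := by
    intro a
    have : ∀ u : Finset (Fin n), D (∏ i ∈ u, c i ^ a i) =
      (t * (∑ i ∈ u, (a i : K) * e ^ i.val) - (∑ i ∈ u, a i : ℕ) * y 0) * ∏ i ∈ u, c i ^ a i := by
      intro u
      induction u using Finset.induction_on with
      | empty => simp
      | insert i u hi ih =>
        rw [Finset.prod_insert hi, Finset.sum_insert hi, Finset.sum_insert hi, Derivation.leibniz, ih,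
          Derivation.leibniz_pow, Dc]
        simp only [smul_eq_mul, nsmul_eq_mul]
        rcases Nat.eq_zero_or_pos (a i) with h | h
        · simp [h]
        · obtain ⟨b, hb⟩ : ∃ b, a i = b + 1 := ⟨a i - 1, by omega⟩
          rw [hb]
          rw [Nat.add_sub_cancel]
          push_cast
          ring
    exact this Finset.univ
  have eP : aeval c P = ∑ a ∈ s, ((MvPolynomial.coeff a P : k') : K) * mon a := by
    rw [aeval_def, eval₂_eq' ]
    refine Finset.sum_subset Finset.subset_union_left fun a _ ha => ?_
    rw [notMem_support_iff.1 ha]; simp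
  have eQ : aeval c Q = ∑ a ∈ s, ((MvPolynomial.coeff a Q : k') : K) * mon a := by
    rw [aeval_def, eval₂_eq' ]
    refine Finset.sum_subset Finset.subset_union_right fun a _ ha => ?_
    rw [notMem_support_iff.1 ha]; simp
  have hsN : ∀ a ∈ s, ∑ i, a i = N := by
    intro a ha
    rw [← Finsupp.degree_eq_sum]
    rcases Finset.mem_union.1 ha with h | h
    · by_contra h3; exact mem_support_iff.1 h (hP.coeff_eq_zero h3)
    · by_contra h3; exact mem_support_iff.1 h (hQ.coeff_eq_zero h3)
  let T : Module.End k K :=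
    { toFun := fun z => t⁻¹ * (D z + N * y 0 * z)
      map_add' := fun z w => by rw [map_add]; ring
      map_smul' := fun b z => by
        rw [Algebra.smul_def, Derivation.leibniz, hD, RingHom.id_apply, Algebra.smul_def b]
        simp only [smul_eq_mul]
        ring }
  let z : (Fin n →₀ ℕ) → K := fun a => (((MvPolynomial.coeff a P : k') : K) - f * ((MvPolynomial.coeff a Q : k') : K)) * mon a
  have hz := aux_eigen T s (fun a => ∑ i, (a i : k) * ε ^ i.val)
    (fun a ha b hb h => aux_weights hp hε a b ((hsN a ha).trans (hsN b hb).symm) h) z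
    (by
      intro a ha
      change t⁻¹ * (D (z a) + N * y 0 * z a) = _
      have hc : D (((MvPolynomial.coeff a P : k') : K) - f * ((MvPolynomial.coeff a Q : k') : K)) = 0 := by
        rw [map_sub, Derivation.leibniz, hDk', hDk', hf]; simp
      simp only [z]
      rw [Derivation.leibniz, hc, Dmon, hsN a ha, Algebra.smul_def (∑ i, (a i : k) * ε ^ i.val)]
      simp only [map_sum, map_mul, map_pow, map_natCast, smul_eq_mul, mul_zero, add_zero]
      rw [← he_def]
      field_simp
      ring)
    (by
      simp only [z, sub_mul, Finset.sum_sub_distrib, mul_assoc]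
      rw [← Finset.mul_sum, ← eP, ← eQ, hP', hQ', hpq]; ring)
  have hQne : aeval c Q ≠ 0 := by
    rw [hQ']; exact mul_ne_zero hq (pow_ne_zero _ W0)
  rw [eQ] at hQne
  obtain ⟨a, ha, hane⟩ := Finset.exists_ne_zero_of_sum_ne_zero hQne
  have hza := hz a ha
  simp only [z] at hza
  have hcQ : ((MvPolynomial.coeff a Q : k') : K) ≠ 0 := left_ne_zero_of_mul hane
  have h5 := (mul_eq_zero.1 hza).resolve_right (right_ne_zero_of_mul hane)
  have h6 : f = ((MvPolynomial.coeff a P : k') : K) / ((MvPolynomial.coeff a Q : k') : K) := by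
    rw [eq_div_iff hcQ]; exact (sub_eq_zero.1 h5).symm
  rw [h6]
  exact k'.div_mem (MvPolynomial.coeff a P).2 (MvPolynomial.coeff a Q).2

lemma aux_descent {k F K : Type*} [Field k] [Field F] [Field K] [Algebra k F] [Algebra k K]
    [Algebra F K] [IsScalarTower k F K] (n : ℕ) (hn : 0 < n) (v : F) (t : K)
    (ht : t ^ n = algebraMap F K v)
    (hirr : Irreducible (Polynomial.X ^ n - Polynomial.C v : Polynomial F))
    (f : F) (hf : algebraMap F K f ∈ IntermediateField.adjoin k {t}) :
    f ∈ IntermediateField.adjoin k {v} := by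
  let E := IntermediateField.adjoin k {v}
  have hmin : minpoly F t = Polynomial.X ^ n - Polynomial.C v :=
    (minpoly.eq_of_irreducible_of_monic hirr (by simp [ht])
      (Polynomial.monic_X_pow_sub_C v hn.ne')).symm
  have hmonic : (Polynomial.X ^ n - Polynomial.C (⟨v, IntermediateField.mem_adjoin_simple_self k v⟩ : E)
      : Polynomial E).Monic := Polynomial.monic_X_pow_sub_C _ hn.ne'
  have hroot : Polynomial.aeval t (Polynomial.X ^ n -
      Polynomial.C (⟨v, IntermediateField.mem_adjoin_simple_self k v⟩ : E) : Polynomial E) = 0 := by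
    simp only [map_sub, map_pow, Polynomial.aeval_X, Polynomial.aeval_C, ht]
    exact sub_self _
  have hInt : IsIntegral E t := ⟨_, hmonic, hroot⟩
  have h1 : ∀ z ∈ IntermediateField.adjoin k {t}, z ∈ IntermediateField.adjoin E {t} := by
    intro z hz
    refine IntermediateField.adjoin_induction (F := k) (s := {t})
      (p := fun z _ => z ∈ IntermediateField.adjoin E {t}) ?_ ?_ ?_ ?_ ?_ hz
    · rintro z rfl; exact IntermediateField.mem_adjoin_simple_self E z
    · intro a
      rw [IsScalarTower.algebraMap_apply k E K]
      exact IntermediateField.algebraMap_mem _ _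
    · intro z w _ _ hz hw; exact add_mem hz hw
    · intro z _ hz; exact inv_mem hz
    · intro z w _ _ hz hw; exact mul_mem hz hw
  have h2 := h1 _ hf
  rw [← IntermediateField.mem_toSubalgebra,
    IntermediateField.adjoin_simple_toSubalgebra_of_isAlgebraic hInt.isAlgebraic,
    Algebra.adjoin_singleton_eq_range_aeval] at h2
  obtain ⟨g, hg⟩ := h2
  replace hg : Polynomial.aeval t g = algebraMap F K f := hg
  set m : Polynomial E := Polynomial.X ^ n -
      Polynomial.C (⟨v, IntermediateField.mem_adjoin_simple_self k v⟩ : E) with hm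
  have hmdeg : m.natDegree = n := Polynomial.natDegree_X_pow_sub_C
  rw [← Polynomial.modByMonic_add_div g m, map_add, map_mul, hroot, zero_mul, add_zero] at hg
  have hdeg : (g %ₘ m).natDegree < n := by
    have := Polynomial.natDegree_modByMonic_lt g hmonic (by
      intro h; rw [h, Polynomial.natDegree_one] at hmdeg; omega)
    rwa [hmdeg] at this
  generalize g %ₘ m = r at *
  let r' : Polynomial F := r.map (algebraMap E F)
  have hr' : Polynomial.aeval t (r' - Polynomial.C f) = 0 := by
    rw [map_sub, Polynomial.aeval_C, ← hg, Polynomial.aeval_map_algebraMap, sub_self]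
  have hz : r' - Polynomial.C f = 0 := by
    by_contra hne
    have h3 := Polynomial.natDegree_le_of_dvd (minpoly.dvd F t hr') hne
    rw [hmin, Polynomial.natDegree_X_pow_sub_C] at h3
    have h4 : (r' - Polynomial.C f).natDegree ≤ r.natDegree := by
      rw [Polynomial.natDegree_sub_C]
      exact Polynomial.natDegree_map_le
    omega
  have h5 := congrArg (fun P => Polynomial.coeff P 0) (sub_eq_zero.1 hz)
  simp only [r', Polynomial.coeff_map, Polynomial.coeff_C_zero] at h5
  rw [← h5]
  exact (r.coeff 0).2

/-- The differential structure on a field given by an additive map with the Leibniz rule. -/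
@[reducible]
def aux_diff {F : Type*} [Field F] (g : F → F) (ha : ∀ a b, g (a + b) = g a + g b)
    (hm : ∀ a b, g (a * b) = a * g b + b * g a) : Differential F :=
  ⟨Derivation.mk' (AddMonoidHom.toIntLinearMap (AddMonoidHom.mk' g ha)) hm⟩

lemma aux_root {K : Type*} [Field K] [CharZero K] (D : Derivation ℤ K K) (n : ℕ) (hn : n ≠ 0)
    (t : K) (ht0 : t ≠ 0) (h1 : D (t ^ n) = 0) : D t = 0 := by
  rw [Derivation.leibniz_pow] at h1
  simp only [smul_eq_mul, nsmul_eq_mul, mul_eq_zero, Nat.cast_eq_zero] at h1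
  rcases h1 with h1 | h1 | h1
  · omega
  · exact absurd h1 (pow_ne_zero _ ht0)
  · exact h1

lemma aux_not_pow {k : Type*} [Field k] (n : ℕ) (hn : 2 ≤ n) [NeZero n]
    (b : FractionRing (MvPolynomial (ZMod n) k)) :
    b ^ n ≠ algebraMap (MvPolynomial (ZMod n) k) (FractionRing (MvPolynomial (ZMod n) k))
      (∏ i : ZMod n, X i) := by
  classical
  intro hb
  have hInt : IsIntegral (MvPolynomial (ZMod n) k) b := by
    refine IsIntegral.of_pow (n := n) (by omega) ?_
    rw [hb]; exact isIntegral_algebraMap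
  obtain ⟨g, rfl⟩ := IsIntegrallyClosed.isIntegral_iff.1 hInt
  rw [← map_pow] at hb
  have hg : g ^ n = ∏ i : ZMod n, X i := IsFractionRing.injective _ _ hb
  have hX : Prime (X 0 : MvPolynomial (ZMod n) k) := MvPolynomial.X_prime
  have h1 : X 0 ∣ g := hX.dvd_of_dvd_pow (hg ▸ Finset.dvd_prod_of_mem _ (Finset.mem_univ 0))
  have h2 : (X 0 : MvPolynomial (ZMod n) k) ^ 2 ∣ ∏ i : ZMod n, X i :=
    hg ▸ (pow_dvd_pow _ hn).trans (pow_dvd_pow_of_dvd h1 n)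
  rw [← Finset.mul_prod_erase _ _ (Finset.mem_univ (0 : ZMod n)), sq] at h2
  have h3 := (mul_dvd_mul_iff_left hX.ne_zero).1 h2
  obtain ⟨j, hj, hj'⟩ := (hX.dvd_finsetProd_iff _).1 h3
  exact (Finset.ne_of_mem_erase hj) (MvPolynomial.X_dvd_X.1 hj').symm

/-- If `n` is prime, then the field of constants of the factorisable
derivation `Δ` of `k(y_0,…,y_{n-1})` (with `Δ(y_j) = y_j(y_{j+1} - y_j)`, indices mod `n`)
is `k(v)`, where `v = y_0 y_1 ⋯ y_{n-1}`: a rational function `f` satisfies `Δ(f) = 0`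
iff `f ∈ k(v)`. -/
theorem stmt_19 {k : Type*} [Field k] [CharZero k] (n : ℕ) (hn : 3 ≤ n) [NeZero n]
    (hprime : n.Prime) (ε : k) (hε : IsPrimitiveRoot ε n)
    (Δ : Derivation k (FractionRing (MvPolynomial (ZMod n) k))
      (FractionRing (MvPolynomial (ZMod n) k)))
    (hΔ : ∀ j : ZMod n,
      Δ (algebraMap (MvPolynomial (ZMod n) k) (FractionRing (MvPolynomial (ZMod n) k)) (X j))
        = algebraMap (MvPolynomial (ZMod n) k) (FractionRing (MvPolynomial (ZMod n) k))
            (X j * (X (j + 1) - X j))) :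
    {f : FractionRing (MvPolynomial (ZMod n) k) | Δ f = 0}
      = ↑(IntermediateField.adjoin k
          ({algebraMap (MvPolynomial (ZMod n) k) (FractionRing (MvPolynomial (ZMod n) k))
              (∏ i : ZMod n, X i)} :
            Set (FractionRing (MvPolynomial (ZMod n) k)))) := by
  classical
  set F := FractionRing (MvPolynomial (ZMod n) k) with hF
  set v : F := algebraMap (MvPolynomial (ZMod n) k) F (∏ i : ZMod n, X i) with hv
  let yF : ZMod n → F := fun j => algebraMap (MvPolynomial (ZMod n) k) F (X j)
  have hyF0 : ∀ j, yF j ≠ 0 := fun j => by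
    simp only [yF, ne_eq, map_eq_zero_iff _ (IsFractionRing.injective (MvPolynomial (ZMod n) k) F)]
    exact X_ne_zero j
  have hyF : ∀ j, Δ (yF j) = yF j * (yF (j + 1) - yF j) := fun j => by
    rw [hΔ, map_mul, map_sub]
  have hvF : v = ∏ j, yF j := by rw [hv, map_prod]
  have hprod : ∀ s : Finset (ZMod n), Δ (∏ j ∈ s, yF j) =
      (∑ j ∈ s, (yF (j + 1) - yF j)) * ∏ j ∈ s, yF j := by
    intro s
    induction s using Finset.induction_on with
    | empty => simp
    | insert a s ha ih =>
      rw [Finset.prod_insert ha, Finset.sum_insert ha, Derivation.leibniz, ih, hyF]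
      simp only [smul_eq_mul]
      ring
  have hΔv : Δ v = 0 := by
    rw [hvF, hprod, Finset.sum_sub_distrib,
      Fintype.sum_equiv (Equiv.addRight (1 : ZMod n)) (fun j => yF (j + 1)) yF (fun j => rfl),
      sub_self, zero_mul]
  ext f
  simp only [Set.mem_ofPred_eq, SetLike.mem_coe]
  constructor
  · intro hf
    have hcz : CharZero F := charZero_of_injective_algebraMap (algebraMap k F).injective
    let m : Polynomial F := Polynomial.X ^ n - Polynomial.C v
    have hirr : Irreducible m :=
      X_pow_sub_C_irreducible_of_prime hprime (aux_not_pow n (by omega))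
    have hmon : m.Monic := Polynomial.monic_X_pow_sub_C _ (by omega)
    haveI : Fact (Irreducible m) := ⟨hirr⟩
    haveI : Fact m.Monic := ⟨hmon⟩
    letI : Differential F := aux_diff (fun a => Δ a) (fun a b => map_add Δ a b) (fun a b => Δ.leibniz a b)
    have hder : ∀ a : F, Differential.deriv (algebraMap F (AdjoinRoot m) a)
        = algebraMap F (AdjoinRoot m) (Δ a) := fun a => deriv_algebraMap a
    have ht : (AdjoinRoot.root m) ^ n = algebraMap F (AdjoinRoot m) v := by
      have := AdjoinRoot.eval₂_root m
      simp only [m, Polynomial.eval₂_sub, Polynomial.eval₂_pow, Polynomial.eval₂_X,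
        Polynomial.eval₂_C] at this
      exact sub_eq_zero.1 this
    haveI : CharZero (AdjoinRoot m) :=
      charZero_of_injective_algebraMap (algebraMap F (AdjoinRoot m)).injective
    have hv0 : v ≠ 0 := hvF ▸ Finset.prod_ne_zero_iff.2 fun j _ => hyF0 j
    have ht0 : AdjoinRoot.root m ≠ 0 := by
      intro h
      rw [h, zero_pow (by omega)] at ht
      exact hv0 ((map_eq_zero _).1 ht.symm)
    have hDt : Differential.deriv (AdjoinRoot.root m) = 0 := by
      refine aux_root Differential.deriv n (by omega) _ ht0 ?_
      rw [ht, hder, hΔv, map_zero]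
    obtain ⟨p, q, hq, hpq⟩ := IsFractionRing.div_surjective (A := MvPolynomial (ZMod n) k) f
    have hq0 : algebraMap (MvPolynomial (ZMod n) k) F q ≠ 0 :=
      IsFractionRing.to_map_ne_zero_of_mem_nonZeroDivisors hq
    have hae : ∀ r : MvPolynomial (ZMod n) k,
        aeval (fun j => algebraMap F (AdjoinRoot m) (yF j)) r
          = algebraMap F (AdjoinRoot m) (algebraMap (MvPolynomial (ZMod n) k) F r) := by
      intro r
      have h1 : aeval yF r = algebraMap (MvPolynomial (ZMod n) k) F r := by
        have := MvPolynomial.aeval_algebraMap_apply F (X : ZMod n → MvPolynomial (ZMod n) k) r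
        rw [MvPolynomial.aeval_X_left_apply] at this
        exact this
      rw [← h1]
      exact MvPolynomial.aeval_algebraMap_apply (AdjoinRoot m) yF r
    refine aux_descent n (by omega) v (AdjoinRoot.root m) ht hirr f ?_
    refine aux_core n hprime ε hε Differential.deriv ?_
      (fun j => algebraMap F (AdjoinRoot m) (yF j)) ?_ ?_ _ ?_ hDt _ ?_ p q ?_ ?_
    · intro c
      rw [IsScalarTower.algebraMap_apply k F (AdjoinRoot m), hder, Derivation.map_algebraMap,
        map_zero]
    · intro j
      exact (map_ne_zero _).2 (hyF0 j)
    · intro j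
      rw [hder, hyF, map_mul, map_sub]
    · rw [ht, hvF, map_prod]
    · rw [hder, hf, map_zero]
    · rw [hae]; exact (map_ne_zero _).2 hq0
    · rw [hae, hae, ← map_mul, ← hpq, div_mul_cancel₀ _ hq0]
  · intro hf
    refine IntermediateField.adjoin_induction (F := k) (s := {v}) (p := fun z _ => Δ z = 0)
      ?_ ?_ ?_ ?_ ?_ hf
    · rintro z rfl; exact hΔv
    · intro c; exact Δ.map_algebraMap c
    · intro z w _ _ hz hw; rw [map_add, hz, hw, add_zero]
    · intro z _ hz; rw [Derivation.leibniz_inv, hz, smul_zero]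
    · intro z w _ _ hz hw; rw [Derivation.leibniz, hz, hw, smul_zero, smul_zero, add_zero]
end
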